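/- arXiv:0910.2378 — 3 statements merged into one kernel-verified Lean document; each statement's English description precedes it below -/
import Mathlib

section
/- Let G be a finite group and H a finitely generated infinite group. Then asdim_AN(G*H) = asdim_AN(H). (This follows from the chain of inequalities asdim_AN(H) ≤ asdim_AN(G*H) ≤ asdim_AN((G×ℤ)*H) ≤ asdim_AN(H).) -/
section Chains

variable {Y : Type*}

/-- An `r`-chain from `x` to `y` inside the set `S`, with respect to the distance
function `d`: a finite sequence `x = c 0, c 1, …, c m = y` of points of `S` with
consecutive distances `< r`. -/
def IsDChain (d : Y → Y → ℝ) (r : ℝ) (S : Set Y) (x y : Y) : Prop :=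
  ∃ (m : ℕ) (c : ℕ → Y), c 0 = x ∧ c m = y ∧ (∀ i ≤ m, c i ∈ S) ∧
    ∀ i < m, d (c i) (c (i + 1)) < r

/-- A set is `r`-scale connected if every two of its points are joined by an
`r`-chain contained in it. -/
def DScaleConnected (d : Y → Y → ℝ) (r : ℝ) (S : Set Y) : Prop :=
  ∀ x ∈ S, ∀ y ∈ S, IsDChain d r S x y

/-- `C` is an `r`-scale connected component of `U`: a maximal `r`-scale connected
subset of `U`. -/
def IsDComponent (d : Y → Y → ℝ) (r : ℝ) (U C : Set Y) : Prop :=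
  C ⊆ U ∧ DScaleConnected d r C ∧
    ∀ C', C ⊆ C' → C' ⊆ U → DScaleConnected d r C' → C = C'

/-- A set is `M`-bounded: its diameter is at most `M`. -/
def DBounded (d : Y → Y → ℝ) (M : ℝ) (S : Set Y) : Prop :=
  ∀ x ∈ S, ∀ y ∈ S, d x y ≤ M

/-- A space has dimension `≤ n` at scale `s` of magnitude `M` if there is a cover by
`n + 1` sets such that every `s`-scale connected component of each of them is
`M`-bounded. -/
def DimLeAtScale (d : Y → Y → ℝ) (n : ℕ) (s M : ℝ) : Prop :=
  ∃ U : Fin (n + 1) → Set Y, (∀ y, ∃ i, y ∈ U i) ∧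
    ∀ i C, IsDComponent d s (U i) C → DBounded d M C

end Chains
section WordMetric

variable {G : Type*} [Group G]

/-- The word length of `g` with respect to the generating set `S`: the least number of
factors from `S ∪ S⁻¹` needed to write `g`. -/
noncomputable def wordLength (S : Set G) (g : G) : ℕ :=
  sInf {m : ℕ | ∃ l : List G, l.length = m ∧ (∀ x ∈ l, x ∈ S ∨ x⁻¹ ∈ S) ∧ l.prod = g}

/-- The word metric on `G` associated with the generating set `S`. -/
noncomputable def wordDist (S : Set G) (g h : G) : ℝ :=
  (wordLength S (g⁻¹ * h) : ℝ)

end WordMetric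

section ANdim

variable {Y : Type*}

/-- `f` is an `n`-dimensional control function: for every scale `s > 0` the space has
dimension `≤ n` at scale `s` of magnitude `f s`. -/
def IsControlFunction (d : Y → Y → ℝ) (n : ℕ) (f : ℝ → ℝ) : Prop :=
  ∀ s : ℝ, 0 < s → DimLeAtScale d n s (f s)

/-- Asymptotic Assouad–Nagata dimension is at most `n`: there is a linear
`n`-dimensional control function. -/
def ANdimLe (d : Y → Y → ℝ) (n : ℕ) : Prop :=
  ∃ C b : ℝ, 0 < C ∧ 0 < b ∧ IsControlFunction d n (fun s => C * s + b)

/-- The asymptotic Assouad–Nagata dimension: the least `n` admitting a linear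
`n`-dimensional control function (`⊤` if there is none). -/
noncomputable def asdimAN (d : Y → Y → ℝ) : ℕ∞ :=
  sInf {N : ℕ∞ | ∃ n : ℕ, N = (n : ℕ∞) ∧ ANdimLe d n}

end ANdim
section Chains

variable {Y : Type*} {d : Y → Y → ℝ} {r : ℝ} {S : Set Y}

theorem IsDChain.mem_left {x y : Y} (h : IsDChain d r S x y) : x ∈ S := by
  obtain ⟨m, c, rfl, -, hc, -⟩ := h
  exact hc 0 (Nat.zero_le m)

theorem IsDChain.mem_right {x y : Y} (h : IsDChain d r S x y) : y ∈ S := by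
  obtain ⟨m, c, -, rfl, hc, -⟩ := h
  exact hc m le_rfl

theorem IsDChain.refl {x : Y} (hx : x ∈ S) : IsDChain d r S x x :=
  ⟨0, fun _ => x, rfl, rfl, fun _ _ => hx, fun i hi => absurd hi (Nat.not_lt_zero i)⟩

theorem IsDChain.snoc {x y z : Y} (h : IsDChain d r S x y) (hz : z ∈ S) (hyz : d y z < r) :
    IsDChain d r S x z := by
  obtain ⟨m, c, rfl, rfl, hc, hd⟩ := h
  refine ⟨m + 1, fun i => if i ≤ m then c i else z, by simp, by simp, ?_, ?_⟩
  · intro i _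
    by_cases h : i ≤ m
    · simpa [h] using hc i h
    · simpa [h] using hz
  · intro i hi
    rcases Nat.lt_succ_iff_lt_or_eq.mp hi with h | rfl
    · simpa [h.le, Nat.succ_le_of_lt h] using hd i h
    · simpa using hyz

/-- Induction on the length of a chain, adding points at its end. -/
theorem IsDChain.induction {x y : Y} {P : Y → Prop} (h : IsDChain d r S x y) (base : P x)
    (step : ∀ a b, IsDChain d r S x a → b ∈ S → d a b < r → P a → P b) : P y := by
  obtain ⟨m, c, rfl, rfl, hc, hd⟩ := h
  have key : ∀ i ≤ m, IsDChain d r S (c 0) (c i) ∧ P (c i) := by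
    intro i
    induction i with
    | zero => exact fun hi => ⟨.refl (hc 0 hi), base⟩
    | succ i ih =>
      intro hi
      obtain ⟨h₁, h₂⟩ := ih (by lia)
      exact ⟨h₁.snoc (hc _ hi) (hd i hi), step _ _ h₁ (hc _ hi) (hd i hi) h₂⟩
  exact (key m le_rfl).2

theorem IsDChain.trans {x y z : Y} (h : IsDChain d r S x y) (h' : IsDChain d r S y z) :
    IsDChain d r S x z :=
  h'.induction h fun _ _ _ hb hab ih => ih.snoc hb hab

theorem IsDChain.symm (hd : ∀ a b, d a b = d b a) {x y : Y} (h : IsDChain d r S x y) :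
    IsDChain d r S y x := by
  refine h.induction (P := fun z => IsDChain d r S z x) (.refl h.mem_left) ?_
  intro a b ha hb hab ih
  exact ((IsDChain.refl hb).snoc ha.mem_right (hd a b ▸ hab)).trans ih

theorem IsDChain.mono {S' : Set Y} (hS : S ⊆ S') {x y : Y} (h : IsDChain d r S x y) :
    IsDChain d r S' x y :=
  h.induction (.refl (hS h.mem_left)) fun _ _ _ hb hab ih => ih.snoc (hS hb) hab

theorem isDComponent_setOf_isDChain (hd : ∀ a b, d a b = d b a) {x : Y} (hx : x ∈ S) :
    IsDComponent d r S {z | IsDChain d r S x z} := by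
  have from_base : ∀ z, IsDChain d r S x z → IsDChain d r {z | IsDChain d r S x z} x z := by
    intro z hz
    refine hz.induction (IsDChain.refl (.refl hx)) ?_
    intro a b ha hb hab ih
    exact ih.snoc (ha.snoc hb hab) hab
  refine ⟨fun z hz => IsDChain.mem_right hz, ?_, ?_⟩
  · intro a ha b hb
    exact ((from_base a ha).symm hd).trans (from_base b hb)
  · intro C' hC hC'U hconn
    refine hC.antisymm fun z hz => ?_
    exact (hconn x (hC (.refl hx)) z hz).mono hC'U

/-- For a symmetric distance, bounding the components amounts to bounding the distance of
points joined by a chain. -/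
theorem dimLeAtScale_iff (hd : ∀ a b, d a b = d b a) {n : ℕ} {s M : ℝ} :
    DimLeAtScale d n s M ↔ ∃ U : Fin (n + 1) → Set Y, (∀ y, ∃ i, y ∈ U i) ∧
      ∀ i x y, IsDChain d s (U i) x y → d x y ≤ M := by
  refine exists_congr fun U => and_congr_right fun _ => forall_congr' fun i => ⟨?_, ?_⟩
  · intro h x y hxy
    exact h _ (isDComponent_setOf_isDChain hd hxy.mem_left) x (.refl hxy.mem_left) y hxy
  · rintro h C ⟨hCU, hC, -⟩ x hx y hy
    exact h x y ((hC x hx y hy).mono hCU)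

/-- The asymptotic Assouad–Nagata dimension passes to isometrically embedded subspaces. -/
theorem ANdimLe.of_isometry {Z : Type*} {e : Z → Z → ℝ} (hd : ∀ a b, d a b = d b a)
    (f : Z → Y) (hf : ∀ a b, d (f a) (f b) = e a b) {n : ℕ} (h : ANdimLe d n) :
    ANdimLe e n := by
  have he : ∀ a b, e a b = e b a := fun a b => by rw [← hf, ← hf, hd]
  obtain ⟨C, b, hC, hb, h⟩ := h
  refine ⟨C, b, hC, hb, fun s hs => ?_⟩
  obtain ⟨U, hU, hUd⟩ := (dimLeAtScale_iff hd).mp (h s hs)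
  refine (dimLeAtScale_iff he).mpr ⟨fun i => f ⁻¹' U i, fun y => hU (f y), ?_⟩
  intro i x y hxy
  rw [← hf]
  refine hUd i _ _ (hxy.induction (P := fun z => IsDChain d s (U i) (f x) (f z))
    (.refl hxy.mem_left) ?_)
  intro a b _ hb' hab ih
  exact ih.snoc hb' (by rwa [hf])

end Chains

section WordLength

variable {X : Type*} [Group X] {A : Set X}

theorem wordLength_prod_le (l : List X) (hl : ∀ x ∈ l, x ∈ A ∨ x⁻¹ ∈ A) :
    wordLength A l.prod ≤ l.length :=
  Nat.sInf_le ⟨l, rfl, hl, rfl⟩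

theorem exists_list_wordLength (hA : Subgroup.closure A = ⊤) (g : X) :
    ∃ l : List X, l.length = wordLength A g ∧ (∀ x ∈ l, x ∈ A ∨ x⁻¹ ∈ A) ∧ l.prod = g := by
  have hg : g ∈ (Subgroup.closure A).toSubmonoid := by simp [hA]
  rw [Subgroup.closure_toSubmonoid] at hg
  obtain ⟨l, hl, hprod⟩ := Submonoid.exists_list_of_mem_closure hg
  exact Nat.sInf_mem (s := {m : ℕ | ∃ l : List X, l.length = m ∧
    (∀ x ∈ l, x ∈ A ∨ x⁻¹ ∈ A) ∧ l.prod = g}) ⟨_, l, rfl, by simpa using hl, hprod⟩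

@[simp]
theorem wordLength_one : wordLength A 1 = 0 := by
  simpa using wordLength_prod_le (A := A) [] (by simp)

theorem wordLength_le_one {g : X} (hg : g ∈ A ∨ g⁻¹ ∈ A) : wordLength A g ≤ 1 := by
  simpa using wordLength_prod_le (A := A) [g] (by simpa using hg)

theorem eq_one_of_wordLength_eq_zero (hA : Subgroup.closure A = ⊤) {g : X}
    (h : wordLength A g = 0) : g = 1 := by
  obtain ⟨l, hl, -, rfl⟩ := exists_list_wordLength hA g
  simp [List.length_eq_zero_iff.mp (hl.trans h)]

theorem wordLength_mul_le (hA : Subgroup.closure A = ⊤) (g h : X) :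
    wordLength A (g * h) ≤ wordLength A g + wordLength A h := by
  obtain ⟨l, hl, hl', rfl⟩ := exists_list_wordLength hA g
  obtain ⟨k, hk, hk', rfl⟩ := exists_list_wordLength hA h
  rw [← hl, ← hk, ← List.length_append, ← List.prod_append]
  refine wordLength_prod_le _ fun x hx => ?_
  rcases List.mem_append.mp hx with hx | hx
  exacts [hl' x hx, hk' x hx]

theorem wordLength_inv_le (hA : Subgroup.closure A = ⊤) (g : X) :
    wordLength A g⁻¹ ≤ wordLength A g := by
  obtain ⟨l, hl, hl', rfl⟩ := exists_list_wordLength hA g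
  rw [← hl, List.prod_inv_reverse]
  refine (wordLength_prod_le _ fun x hx => ?_).trans_eq (by simp)
  obtain ⟨y, hy, rfl⟩ := List.mem_map.mp (List.mem_reverse.mp hx)
  simpa [or_comm] using hl' y hy

theorem wordLength_inv (hA : Subgroup.closure A = ⊤) (g : X) :
    wordLength A g⁻¹ = wordLength A g :=
  (wordLength_inv_le hA g).antisymm (by simpa using wordLength_inv_le hA g⁻¹)

theorem wordDist_comm (hA : Subgroup.closure A = ⊤) (x y : X) :
    wordDist A x y = wordDist A y x := by
  rw [wordDist, wordDist, ← wordLength_inv hA (x⁻¹ * y)]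
  simp

theorem wordDist_triangle (hA : Subgroup.closure A = ⊤) (x y z : X) :
    wordDist A x z ≤ wordDist A x y + wordDist A y z := by
  have := wordLength_mul_le hA (x⁻¹ * y) (y⁻¹ * z)
  rw [wordDist, wordDist, wordDist]
  rw [mul_assoc, mul_inv_cancel_left] at this
  exact_mod_cast this

theorem wordDist_mul_right (x g : X) : wordDist A x (x * g) = wordLength A g := by
  simp [wordDist]

/-- Induction along a geodesic path in the Cayley graph. -/
theorem geodesic_induction (hA : Subgroup.closure A = ⊤) {x y : X} (P : ℕ → X → Prop)
    (base : P 0 x)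
    (step : ∀ m z a, m < wordLength A (x⁻¹ * y) → (a ∈ A ∨ a⁻¹ ∈ A) → P m z →
      P (m + 1) (z * a)) :
    P (wordLength A (x⁻¹ * y)) y := by
  obtain ⟨l, hl, hlA, hprod⟩ := exists_list_wordLength hA (x⁻¹ * y)
  have key : ∀ i ≤ l.length, P i (x * (l.take i).prod) := by
    intro i
    induction i with
    | zero => simpa using base
    | succ i ih =>
      intro hi
      rw [List.prod_take_succ l i hi, ← mul_assoc]
      exact step i _ _ (hl ▸ hi) (hlA _ (l.getElem_mem hi)) (ih (by lia))
  have h := key l.length le_rfl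
  rwa [List.take_length, hprod, mul_inv_cancel_left, hl] at h

theorem finite_setOf_wordLength_le (hA : Subgroup.closure A = ⊤) (hfin : A.Finite) (m : ℕ) :
    {g : X | wordLength A g ≤ m}.Finite := by
  have : Finite ↥(A ∪ A⁻¹) := (hfin.union hfin.inv).to_subtype
  refine ((List.finite_length_le ↥(A ∪ A⁻¹) m).image
    fun l => (l.map Subtype.val).prod).subset ?_
  intro g hg
  obtain ⟨l, hl, hlA, rfl⟩ := exists_list_wordLength hA g
  lift l to List ↥(A ∪ A⁻¹) using by simpa using hlA
  exact ⟨l, by simpa using hl.trans_le hg, rfl⟩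

/-- An infinite finitely generated group does not have asymptotic Assouad–Nagata
dimension zero. -/
theorem not_aNdimLe_zero [Infinite X] (hA : Subgroup.closure A = ⊤) (hfin : A.Finite) :
    ¬ ANdimLe (wordDist A) 0 := by
  rintro ⟨C, b, -, -, h⟩
  obtain ⟨U, hU, hUd⟩ := (dimLeAtScale_iff (wordDist_comm hA)).mp (h 2 two_pos)
  have hmem : ∀ y, y ∈ U 0 := fun y => by
    obtain ⟨i, hi⟩ := hU y
    rwa [show i = 0 from Subsingleton.elim (α := Fin 1) i 0] at hi
  have hbound : ∀ y, wordLength A y ≤ ⌊C * 2 + b⌋₊ := by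
    intro y
    refine Nat.le_floor ?_
    have hchain : IsDChain (wordDist A) 2 (U 0) 1 y :=
      geodesic_induction hA (fun _ z => IsDChain (wordDist A) 2 (U 0) 1 z) (.refl (hmem 1))
        fun m z a _ ha hz => hz.snoc (hmem _) <| by
          have : (wordLength A a : ℝ) ≤ 1 := by exact_mod_cast wordLength_le_one ha
          rw [wordDist_mul_right]
          linarith
    simpa [wordDist] using hUd 0 1 y hchain
  refine Set.infinite_univ ((finite_setOf_wordLength_le hA hfin ⌊C * 2 + b⌋₊).subset ?_)
  exact fun y _ => hbound y

end WordLength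

section NormalForm

open Monoid.Coprod

variable {G H : Type*} [Group G] [Group H]

/-- The pair `(h, [(g₁, h₁), …, (g_k, h_k)])` encodes the product `h_k * g_k * ⋯ * h₁ * g₁ * h`
of `G ∗ H`; the list determines the left coset of `H` containing it. The encoding is reduced
if no `g_i` and no `h_i` is trivial, except possibly `h_k`. -/
def IsReducedStack : List (G × H) → Prop
  | [] => True
  | (g, h) :: st => g ≠ 1 ∧ (h ≠ 1 ∨ st = []) ∧ IsReducedStack st

open Classical in
/-- The effect on encodings of right multiplication by an element of `G`. -/
noncomputable def mulFactor : H × List (G × H) → G → H × List (G × H)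
  | (h, []), g => if g = 1 then (h, []) else (1, [(g, h)])
  | (h, (g', h') :: st), g =>
    if h = 1 then
      if g' * g = 1 then (h', st) else (1, (g' * g, h') :: st)
    else if g = 1 then (h, (g', h') :: st) else (1, (g, h) :: (g', h') :: st)

theorem mulFactor_of_ne {h : H} {st : List (G × H)} (hst : h ≠ 1 ∨ st = []) (g : G)
    [Decidable (g = 1)] :
    mulFactor (h, st) g = if g = 1 then (h, st) else (1, (g, h) :: st) := by
  rcases st with _ | ⟨⟨g', h'⟩, st⟩
  · simp [mulFactor]
  · simp [mulFactor, show h ≠ 1 by simpa using hst]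

theorem isReducedStack_mulFactor {p : H × List (G × H)} (hp : IsReducedStack p.2) (g : G) :
    IsReducedStack (mulFactor p g).2 := by
  rcases p with ⟨h, _ | ⟨⟨g', h'⟩, st⟩⟩
  · simp only [mulFactor]
    split_ifs <;> simp_all [IsReducedStack]
  · simp only [mulFactor]
    simp only [IsReducedStack] at hp
    split_ifs <;> simp_all [IsReducedStack]

theorem mulFactor_one {p : H × List (G × H)} (hp : IsReducedStack p.2) : mulFactor p 1 = p := by
  rcases p with ⟨h, _ | ⟨⟨g', h'⟩, st⟩⟩
  · simp [mulFactor]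
  · simp only [IsReducedStack] at hp
    simp only [mulFactor]
    split_ifs <;> simp_all

theorem mulFactor_one_cons {h : H} {st : List (G × H)} (hst : h ≠ 1 ∨ st = []) (c g : G) :
    mulFactor (1, (c, h) :: st) g = mulFactor (h, st) (c * g) := by
  classical
  rw [mulFactor_of_ne hst]
  simp [mulFactor]

theorem mulFactor_mulFactor {p : H × List (G × H)} (hp : IsReducedStack p.2) (a b : G) :
    mulFactor (mulFactor p a) b = mulFactor p (a * b) := by
  classical
  have of_ne : ∀ {h : H} {st : List (G × H)}, (h ≠ 1 ∨ st = []) → ∀ c,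
      mulFactor (mulFactor (h, st) c) b = mulFactor (h, st) (c * b) := by
    intro h st hst c
    rw [mulFactor_of_ne hst c]
    split_ifs with hc
    · simp [hc]
    · exact mulFactor_one_cons hst c b
  obtain ⟨h, st⟩ := p
  by_cases hst : h ≠ 1 ∨ st = []
  · exact of_ne hst a
  · obtain ⟨rfl, hne⟩ : h = 1 ∧ st ≠ [] := by simpa using hst
    obtain ⟨⟨g', h'⟩, st, rfl⟩ := List.exists_cons_of_ne_nil hne
    have hst' := hp.2.1
    rw [mulFactor_one_cons hst', mulFactor_one_cons hst', of_ne hst', mul_assoc]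

/-- The reduced encodings of elements of `G ∗ H`. -/
abbrev ReducedEncoding (G H : Type*) [Group G] [Group H] : Type _ :=
  {p : H × List (G × H) // IsReducedStack p.2}

/-- The right action of `G ∗ H` on reduced encodings. -/
noncomputable def encodingAction (G H : Type*) [Group G] [Group H] :
    Monoid.Coprod G H →* (Function.End (ReducedEncoding G H))ᵐᵒᵖ :=
  lift
    { toFun := fun g => .op fun n => ⟨mulFactor n.1 g, isReducedStack_mulFactor n.2 g⟩
      map_one' := by
        refine congrArg MulOpposite.op (funext fun n => Subtype.ext (mulFactor_one n.2))
      map_mul' := fun a b =>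
        congrArg MulOpposite.op (funext fun n => Subtype.ext (mulFactor_mulFactor n.2 a b).symm) }
    { toFun := fun h => .op fun n => ⟨(n.1.1 * h, n.1.2), n.2⟩
      map_one' := by
        refine congrArg MulOpposite.op (funext fun n => Subtype.ext ?_)
        exact Prod.ext (mul_one _) rfl
      map_mul' := fun a b => by
        refine congrArg MulOpposite.op (funext fun n => Subtype.ext ?_)
        exact Prod.ext (mul_assoc _ _ _).symm rfl }

/-- The reduced encoding of an element of `G ∗ H`. -/
noncomputable def encode (x : Monoid.Coprod G H) : ReducedEncoding G H :=
  (encodingAction G H x).unop ⟨(1, []), trivial⟩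

theorem encode_mul_inl (x : Monoid.Coprod G H) (g : G) :
    (encode (x * inl g)).1 = mulFactor (encode x).1 g := by
  rw [encode, map_mul]
  rfl

theorem encode_mul_inr (x : Monoid.Coprod G H) (h : H) :
    (encode (x * inr h)).1 = ((encode x).1.1 * h, (encode x).1.2) := by
  rw [encode, map_mul]
  rfl

/-- The base point of the left coset of `H` determined by a list. -/
def decodeStack : List (G × H) → Monoid.Coprod G H
  | [] => 1
  | (g, h) :: st => decodeStack st * inr h * inl g

/-- The element of `G ∗ H` with a given encoding. -/
def decode (p : H × List (G × H)) : Monoid.Coprod G H :=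
  decodeStack p.2 * inr p.1

theorem decode_mulFactor (p : H × List (G × H)) (g : G) :
    decode (mulFactor p g) = decode p * inl g := by
  rcases p with ⟨h, _ | ⟨⟨g', h'⟩, st⟩⟩
  · simp only [mulFactor]
    split_ifs with hg <;> simp [decode, decodeStack, hg]
  · simp only [mulFactor]
    split_ifs with h₁ h₂ h₃
    · simp [decode, decodeStack, h₁, mul_assoc, ← map_mul, h₂]
    · simp [decode, decodeStack, h₁, mul_assoc]
    · simp [h₃]
    · simp [decode, decodeStack, mul_assoc]

theorem decode_encode (x : Monoid.Coprod G H) : decode (encode x).1 = x := by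
  have key : ∀ (x : Monoid.Coprod G H) (n : ReducedEncoding G H),
      decode ((encodingAction G H x).unop n).1 = decode n.1 * x := by
    intro x
    induction x using Monoid.Coprod.induction_on with
    | inl g => exact fun n => decode_mulFactor n.1 g
    | inr h => exact fun n =>
      show decode (n.1.1 * h, n.1.2) = _ by simp [decode, mul_assoc]
    | mul x y hx hy =>
      intro n
      rw [map_mul, ← mul_assoc, ← hx, ← hy]
      rfl
  simpa [encode, decode, decodeStack] using key x ⟨(1, []), trivial⟩

end NormalForm

section Colouring

variable {G H : Type*}

/-- Colour the inner half of a cluster by the colour of its root and the outer half by the next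
colour. -/
def clusterColour {n : ℕ} (u : H → Fin (n + 1)) (R : ℕ) (a : (H × List (G × H)) × ℕ) :
    Fin (n + 1) :=
  if a.2 ≤ R then u a.1.1 else u a.1.1 + 1

theorem depth_le_iff_of_clusterColour_eq {n : ℕ} (hn : n ≠ 0) {u : H → Fin (n + 1)} {R : ℕ}
    {a b : (H × List (G × H)) × ℕ} (hab : a.1 = b.1)
    (h : clusterColour u R a = clusterColour u R b) : a.2 ≤ R ↔ b.2 ≤ R := by
  have hne : ∀ i : Fin (n + 1), i ≠ i + 1 := fun i => by
    obtain ⟨n, rfl⟩ := Nat.exists_eq_succ_of_ne_zero hn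
    simp
  rw [clusterColour, clusterColour, hab] at h
  split_ifs at h with h₁ h₂ h₂
  · simp [h₁, h₂]
  · exact absurd h (hne _)
  · exact absurd h.symm (hne _)
  · simp [h₁, h₂]

end Colouring

section Clusters

variable {G H : Type*} [Group H] (L : H → ℕ) (R : ℕ)

/-- Given the cluster and the depth of the base point of a coset of `H`, the cluster and the
depth of the point `h` of that coset. Points of depth at most `2 * R` stay in the cluster; all
others are roots of new clusters. -/
def extendCluster (a : (H × List (G × H)) × ℕ) (h : H) (st : List (G × H)) :
    (H × List (G × H)) × ℕ :=
  if a.2 + L h ≤ 2 * R then (a.1, a.2 + L h) else ((h, st), 0)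

/-- The root of the cluster containing the base point of a coset of `H`, and the depth of this
base point in the cluster. -/
def stackCluster : List (G × H) → (H × List (G × H)) × ℕ
  | [] => ((1, []), 0)
  | (_, h) :: st => extendCluster L R (stackCluster st) h st

/-- The root of the cluster containing an encoded point, and the depth of the point in it. -/
def pointCluster (p : H × List (G × H)) : (H × List (G × H)) × ℕ :=
  extendCluster L R (stackCluster L R p.2) p.1 p.2

/-- The root of the parent of the cluster with root `q`. -/
def parentCluster (q : H × List (G × H)) : H × List (G × H) :=
  (stackCluster L R q.2).1

/-- The ways in which the cluster and the depth of a point may change when the point moves along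
an edge of the Cayley graph. -/
def ClusterAdj (a b : (H × List (G × H)) × ℕ) : Prop :=
  (a.1 = b.1 ∧ a.2 ≤ b.2 + 1 ∧ b.2 ≤ a.2 + 1) ∨
  (2 * R ≤ a.2 ∧ b.2 = 0 ∧ parentCluster L R b.1 = a.1) ∨
  (a.2 = 0 ∧ 2 * R ≤ b.2 ∧ parentCluster L R a.1 = b.1) ∨
  (a.2 = 0 ∧ b.2 = 0 ∧ a.1.2 = b.1.2 ∧ L (a.1.1⁻¹ * b.1.1) ≤ 1)

/-- The inner half of a cluster is attached to the parent of the cluster, the outer half to the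
cluster itself. -/
def attachingCluster (a : (H × List (G × H)) × ℕ) : H × List (G × H) :=
  if a.2 ≤ R then parentCluster L R a.1 else a.1

variable {L R}

theorem pointCluster_depth_le (p : H × List (G × H)) : (pointCluster L R p).2 ≤ 2 * R := by
  rw [pointCluster, extendCluster]
  split_ifs with h
  exacts [h, Nat.zero_le _]

theorem parentCluster_congr {p q : H × List (G × H)} (h : p.2 = q.2) :
    parentCluster L R p = parentCluster L R q := by
  rw [parentCluster, h, parentCluster]

theorem pointCluster_one_cons (hL : L 1 = 0) (g : G) (h : H) (st : List (G × H)) :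
    pointCluster L R (1, (g, h) :: st) = pointCluster L R (h, st) := by
  have := pointCluster_depth_le (L := L) (R := R) (h, st)
  rw [pointCluster, stackCluster, ← pointCluster.eq_1 L R (h, st), extendCluster]
  simp [hL, this]

theorem pointCluster_mulFactor [Group G] (hL : L 1 = 0) (p : H × List (G × H)) (g : G) :
    pointCluster L R (mulFactor p g) = pointCluster L R p := by
  rcases p with ⟨h, _ | ⟨⟨g', h'⟩, st⟩⟩
  · simp only [mulFactor]
    split_ifs
    exacts [rfl, pointCluster_one_cons hL ..]
  · simp only [mulFactor]
    split_ifs with h₁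
    · rw [h₁, pointCluster_one_cons hL]
    · rw [h₁, pointCluster_one_cons hL, pointCluster_one_cons hL]
    · rfl
    · rw [pointCluster_one_cons hL]

theorem clusterAdj_mul_right {h t : H} (st : List (G × H)) (h₁ : L (h * t) ≤ L h + 1)
    (h₂ : L h ≤ L (h * t) + 1) (ht : L t ≤ 1) :
    ClusterAdj L R (pointCluster L R (h, st)) (pointCluster L R (h * t, st)) := by
  simp only [pointCluster, extendCluster]
  split_ifs with ha hb hb
  · exact .inl ⟨rfl, by lia, by lia⟩
  · exact .inr (.inl ⟨by lia, rfl, rfl⟩)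
  · exact .inr (.inr (.inl ⟨rfl, by lia, rfl⟩))
  · exact .inr (.inr (.inr ⟨rfl, rfl, rfl, by simpa using ht⟩))

/-- The possible positions after `m` steps from a point of the inner half of the cluster with
root `q`. -/
theorem ClusterAdj.inner_step {a b : (H × List (G × H)) × ℕ} (hab : ClusterAdj L R a b)
    {q P : H × List (G × H)} (hP : parentCluster L R q = P) {m : ℕ} (hm : m < R)
    (ha : (a.1 = q ∧ a.2 ≤ R + m) ∨ (parentCluster L R a.1 = P ∧ a.2 ≤ m) ∨
      (a.1 = P ∧ 2 * R ≤ a.2 + m)) :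
    (b.1 = q ∧ b.2 ≤ R + (m + 1)) ∨ (parentCluster L R b.1 = P ∧ b.2 ≤ m + 1) ∨
      (b.1 = P ∧ 2 * R ≤ b.2 + (m + 1)) := by
  rcases hab with ⟨h₁, h₂, h₃⟩ | ⟨h₁, h₂, h₃⟩ | ⟨h₁, h₂, h₃⟩ | ⟨h₁, h₂, h₃, -⟩
  · rw [← h₁]
    rcases ha with ⟨k₁, k₂⟩ | ⟨k₁, k₂⟩ | ⟨k₁, k₂⟩
    exacts [.inl ⟨k₁, by lia⟩, .inr (.inl ⟨k₁, by lia⟩), .inr (.inr ⟨k₁, by lia⟩)]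
  · rcases ha with ⟨k₁, k₂⟩ | ⟨k₁, k₂⟩ | ⟨k₁, k₂⟩
    exacts [by lia, by lia, .inr (.inl ⟨h₃.trans k₁, by lia⟩)]
  · rcases ha with ⟨k₁, k₂⟩ | ⟨k₁, k₂⟩ | ⟨k₁, k₂⟩
    exacts [.inr (.inr ⟨by rw [← h₃, k₁, hP], by lia⟩), .inr (.inr ⟨by rw [← h₃, k₁], by lia⟩),
      by lia]
  · rw [← parentCluster_congr h₃]
    rcases ha with ⟨k₁, k₂⟩ | ⟨k₁, k₂⟩ | ⟨k₁, k₂⟩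
    exacts [.inr (.inl ⟨by rw [k₁, hP], by lia⟩), .inr (.inl ⟨k₁, by lia⟩), by lia]

/-- The possible positions after `m` steps from a point of the outer half of the cluster with
root `P`. -/
theorem ClusterAdj.outer_step {a b : (H × List (G × H)) × ℕ} (hab : ClusterAdj L R a b)
    {P : H × List (G × H)} {m : ℕ} (hm : m < R)
    (ha : (a.1 = P ∧ R < a.2 + m) ∨ (parentCluster L R a.1 = P ∧ a.2 ≤ m)) :
    (b.1 = P ∧ R < b.2 + (m + 1)) ∨ (parentCluster L R b.1 = P ∧ b.2 ≤ m + 1) := by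
  rcases hab with ⟨h₁, h₂, h₃⟩ | ⟨h₁, h₂, h₃⟩ | ⟨h₁, h₂, h₃⟩ | ⟨h₁, h₂, h₃, -⟩
  · rw [← h₁]
    rcases ha with ⟨k₁, k₂⟩ | ⟨k₁, k₂⟩
    exacts [.inl ⟨k₁, by lia⟩, .inr ⟨k₁, by lia⟩]
  · rcases ha with ⟨k₁, k₂⟩ | ⟨k₁, k₂⟩
    exacts [.inr ⟨h₃.trans k₁, by lia⟩, by lia]
  · rcases ha with ⟨k₁, k₂⟩ | ⟨k₁, k₂⟩
    exacts [by lia, .inl ⟨by rw [← h₃, k₁], by lia⟩]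
  · rw [← parentCluster_congr h₃]
    rcases ha with ⟨k₁, k₂⟩ | ⟨k₁, k₂⟩
    exacts [by lia, .inr ⟨k₁, by lia⟩]

/-- A path from the inner half of the cluster with root `q` projects to the coset of `q` as long
as it does not meet the parent cluster. -/
theorem ClusterAdj.sibling_step {a b : (H × List (G × H)) × ℕ} (hab : ClusterAdj L R a b)
    (hL : ∀ g h, L (g * h) ≤ L g + L h) {q : H × List (G × H)} {m : ℕ} (hm : m < R)
    (ha : a.1.2 = q.2 ∧ L (q.1⁻¹ * a.1.1) ≤ m ∧ a.2 ≤ R + m) :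
    (b.1.2 = q.2 ∧ L (q.1⁻¹ * b.1.1) ≤ m + 1 ∧ b.2 ≤ R + (m + 1)) ∨
      b.1 = parentCluster L R q := by
  obtain ⟨k₁, k₂, k₃⟩ := ha
  rcases hab with ⟨h₁, h₂, h₃⟩ | ⟨h₁, h₂, h₃⟩ | ⟨h₁, h₂, h₃⟩ | ⟨h₁, h₂, h₃, h₄⟩
  · rw [← h₁]
    exact .inl ⟨k₁, by lia, by lia⟩
  · lia
  · exact .inr (by rw [← h₃, parentCluster_congr k₁])
  · have h₅ := hL (q.1⁻¹ * a.1.1) (a.1.1⁻¹ * b.1.1)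
    rw [mul_assoc, mul_inv_cancel_left] at h₅
    exact .inl ⟨h₃ ▸ k₁, by lia, by lia⟩

end Clusters

section FreeProduct

open Monoid.Coprod

theorem wordLength_map_le {X Z : Type*} [Group X] [Group Z] {A : Set X} {B : Set Z}
    (hA : Subgroup.closure A = ⊤) (hB : Subgroup.closure B = ⊤) (f : X →* Z)
    (hf : ∀ a ∈ A, wordLength B (f a) ≤ 1) (g : X) :
    wordLength B (f g) ≤ wordLength A g := by
  have h := geodesic_induction hA (x := 1) (y := g) (fun m z => wordLength B (f z) ≤ m)
    (by simp) fun m z a _ ha hz => by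
      have ha' : wordLength B (f a) ≤ 1 := by
        rcases ha with ha | ha
        · exact hf a ha
        · rw [← wordLength_inv hB, ← map_inv]
          exact hf _ ha
      rw [map_mul]
      exact (wordLength_mul_le hB _ _).trans (add_le_add hz ha')
  simpa using h

variable {G H : Type*} [Group G] [Group H]

/-- The generating set of `G ∗ H` given by generating sets of the factors. -/
abbrev coprodGenerators (S : Set G) (T : Set H) : Set (Monoid.Coprod G H) :=
  (⇑(inl : G →* Monoid.Coprod G H) '' S) ∪ (⇑(inr : H →* Monoid.Coprod G H) '' T)

variable {S : Set G} {T : Set H}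

theorem closure_coprodGenerators (hS : Subgroup.closure S = ⊤) (hT : Subgroup.closure T = ⊤) :
    Subgroup.closure (coprodGenerators S T) = ⊤ := by
  rw [Subgroup.closure_union, ← MonoidHom.map_closure, ← MonoidHom.map_closure, hS, hT,
    ← MonoidHom.range_eq_map, ← MonoidHom.range_eq_map, range_inl_sup_range_inr]

theorem wordLength_inr (hS : Subgroup.closure S = ⊤) (hT : Subgroup.closure T = ⊤) (h : H) :
    wordLength (coprodGenerators S T) (inr h) = wordLength T h := by
  have hA := closure_coprodGenerators hS hT
  refine (wordLength_map_le hT hA inr (fun t ht => ?_) h).antisymm ?_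
  · exact wordLength_le_one (.inl (.inr ⟨t, ht, rfl⟩))
  · refine (wordLength_map_le hA hT snd ?_ (inr h)).trans_eq' (by simp)
    rintro _ (⟨s, -, rfl⟩ | ⟨t, ht, rfl⟩)
    · simp
    · simpa using wordLength_le_one (.inl ht)

theorem wordDist_inr (hS : Subgroup.closure S = ⊤) (hT : Subgroup.closure T = ⊤) (h k : H) :
    wordDist (coprodGenerators S T) (inr h) (inr k) = wordDist T h k := by
  rw [wordDist, wordDist, ← map_inv, ← map_mul, wordLength_inr hS hT]

variable (T) in
/-- The root of the cluster of an element of `G ∗ H`, and its depth in the cluster. -/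
noncomputable def clusterOf (R : ℕ) (x : Monoid.Coprod G H) : (H × List (G × H)) × ℕ :=
  pointCluster (wordLength T) R (encode x).1

theorem clusterAdj_clusterOf (hT : Subgroup.closure T = ⊤) (R : ℕ) (x : Monoid.Coprod G H)
    {a : Monoid.Coprod G H} (ha : a ∈ coprodGenerators S T ∨ a⁻¹ ∈ coprodGenerators S T) :
    ClusterAdj (wordLength T) R (clusterOf T R x) (clusterOf T R (x * a)) := by
  have inl_adj : ∀ g, ClusterAdj (wordLength T) R (clusterOf T R x)
      (clusterOf T R (x * inl g)) := by
    intro g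
    rw [clusterOf, clusterOf, encode_mul_inl, pointCluster_mulFactor wordLength_one]
    exact .inl ⟨rfl, by lia, by lia⟩
  have inr_adj : ∀ t, wordLength T t ≤ 1 → ClusterAdj (wordLength T) R (clusterOf T R x)
      (clusterOf T R (x * inr t)) := by
    intro t ht
    rw [clusterOf, clusterOf, encode_mul_inr]
    have h₁ := wordLength_mul_le hT (encode x).1.1 t
    have h₂ := wordLength_mul_le hT ((encode x).1.1 * t) t⁻¹
    rw [mul_inv_cancel_right, wordLength_inv hT] at h₂
    exact clusterAdj_mul_right _ (by lia) (by lia) ht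
  rcases ha with (⟨g, -, rfl⟩ | ⟨t, ht, rfl⟩) | (⟨g, -, hg⟩ | ⟨t, ht, hg⟩)
  · exact inl_adj g
  · exact inr_adj t (wordLength_le_one (.inl ht))
  · rw [eq_inv_of_mul_eq_one_right (a := inl g) (b := a) (by simp [hg]), ← map_inv]
    exact inl_adj g⁻¹
  · rw [eq_inv_of_mul_eq_one_right (a := inr t) (b := a) (by simp [hg]), ← map_inv]
    exact inr_adj t⁻¹ (wordLength_le_one (.inr (by simpa using ht)))

theorem wordLength_decode_pointCluster_le (hS : Subgroup.closure S = ⊤)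
    (hT : Subgroup.closure T = ⊤) {K : ℕ}
    (hK : ∀ g : G, wordLength (coprodGenerators S T) (inl g) ≤ K) (R : ℕ) (h : H)
    (st : List (G × H)) (hst : IsReducedStack st) :
    wordLength (coprodGenerators S T)
        ((decode (pointCluster (wordLength T) R (h, st)).1)⁻¹ * decode (h, st)) ≤
      (K + 1) * (pointCluster (wordLength T) R (h, st)).2 + K ∧
    (h ≠ 1 ∨ st = [] → wordLength (coprodGenerators S T)
        ((decode (pointCluster (wordLength T) R (h, st)).1)⁻¹ * decode (h, st)) ≤
      (K + 1) * (pointCluster (wordLength T) R (h, st)).2) := by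
  have hA := closure_coprodGenerators hS hT
  induction st generalizing h with
  | nil =>
    suffices hsuff : _ ≤ _ from ⟨hsuff.trans (Nat.le_add_right _ _), fun _ => hsuff⟩
    rw [pointCluster, extendCluster]
    split_ifs with hh
    · simp only [stackCluster, decode, decodeStack, map_one, mul_one, inv_one, one_mul,
        wordLength_inr hS hT, zero_add]
      nlinarith
    · simp
  | cons gh st ih =>
    obtain ⟨g, h'⟩ := gh
    obtain ⟨-, hh', hst⟩ := hst
    have ih := (ih h' hst).2 hh'
    rw [pointCluster, extendCluster, stackCluster, ← pointCluster.eq_1 _ R (h', st)]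
    generalize pointCluster (wordLength T) R (h', st) = a at ih
    split_ifs with hh
    · have hle : wordLength (coprodGenerators S T) ((decode a.1)⁻¹ * decode (h, (g, h') :: st)) ≤
          (K + 1) * a.2 + K + wordLength T h := by
        have h₁ := wordLength_mul_le hA ((decode a.1)⁻¹ * decode (h', st)) (inl g)
        have h₂ := wordLength_mul_le hA ((decode a.1)⁻¹ * decode (h', st) * inl g) (inr h)
        rw [wordLength_inr hS hT] at h₂
        have h₃ : (decode a.1)⁻¹ * decode (h, (g, h') :: st) =
            (decode a.1)⁻¹ * decode (h', st) * inl g * inr h := by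
          simp [decode, decodeStack, mul_assoc]
        rw [h₃]
        linarith [hK g]
      refine ⟨by nlinarith, ?_⟩
      rintro (hne | hne)
      · have hpos : 1 ≤ wordLength T h :=
          Nat.one_le_iff_ne_zero.mpr (mt (eq_one_of_wordLength_eq_zero hT) hne)
        dsimp only
        nlinarith
      · simp at hne
    · simp

theorem wordDist_decode_clusterOf_le (hS : Subgroup.closure S = ⊤)
    (hT : Subgroup.closure T = ⊤) {K : ℕ}
    (hK : ∀ g : G, wordLength (coprodGenerators S T) (inl g) ≤ K) (R : ℕ)
    (x : Monoid.Coprod G H) :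
    wordDist (coprodGenerators S T) x (decode (clusterOf T R x).1) ≤
      (K + 1) * (2 * R) + K := by
  have h := (wordLength_decode_pointCluster_le hS hT hK R (encode x).1.1 _ (encode x).2).1
  rw [wordDist_comm (closure_coprodGenerators hS hT)]
  nth_rewrite 2 [← decode_encode x]
  refine (Nat.cast_le.mpr (h.trans (Nat.add_le_add_right
    (Nat.mul_le_mul_left _ (pointCluster_depth_le _)) K))).trans_eq ?_
  push_cast
  ring

theorem wordDist_decode (hS : Subgroup.closure S = ⊤) (hT : Subgroup.closure T = ⊤)
    {p q : H × List (G × H)} (h : p.2 = q.2) :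
    wordDist (coprodGenerators S T) (decode p) (decode q) = wordDist T p.1 q.1 := by
  rw [← wordDist_inr hS hT, wordDist, wordDist, decode, decode, h]
  simp [mul_assoc]

theorem attachingCluster_eq_of_depth_le (hS : Subgroup.closure S = ⊤)
    (hT : Subgroup.closure T = ⊤) {n : ℕ} (hn : n ≠ 0) {u : H → Fin (n + 1)} {R : ℕ}
    {x y : Monoid.Coprod G H} (hxy : wordLength (coprodGenerators S T) (x⁻¹ * y) < R)
    (hcol : clusterColour u R (clusterOf T R x) = clusterColour u R (clusterOf T R y))
    (hx : (clusterOf T R x).2 ≤ R) :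
    attachingCluster (wordLength T) R (clusterOf T R x) =
      attachingCluster (wordLength T) R (clusterOf T R y) := by
  have key := geodesic_induction (closure_coprodGenerators hS hT) (x := x) (y := y)
    (fun m z => ((clusterOf T R z).1 = (clusterOf T R x).1 ∧ (clusterOf T R z).2 ≤ R + m) ∨
      (parentCluster (wordLength T) R (clusterOf T R z).1 =
        parentCluster (wordLength T) R (clusterOf T R x).1 ∧ (clusterOf T R z).2 ≤ m) ∨
      ((clusterOf T R z).1 = parentCluster (wordLength T) R (clusterOf T R x).1 ∧
        2 * R ≤ (clusterOf T R z).2 + m))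
    (.inl ⟨rfl, hx⟩)
    (fun m z a hm ha hz => (clusterAdj_clusterOf hT R z ha).inner_step rfl (hm.trans hxy) hz)
  rw [attachingCluster, attachingCluster, if_pos hx]
  rcases key with ⟨h₁, -⟩ | ⟨h₁, h₂⟩ | ⟨h₁, h₂⟩
  · rw [if_pos ((depth_le_iff_of_clusterColour_eq hn h₁ hcol.symm).mpr hx), h₁]
  · rw [if_pos (h₂.trans hxy.le), h₁]
  · rw [if_neg (by lia), h₁]

/-- Close points of the same colour are attached to the same cluster. -/
theorem attachingCluster_eq (hS : Subgroup.closure S = ⊤)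
    (hT : Subgroup.closure T = ⊤) {n : ℕ} (hn : n ≠ 0) {u : H → Fin (n + 1)} {R : ℕ}
    {x y : Monoid.Coprod G H} (hxy : wordLength (coprodGenerators S T) (x⁻¹ * y) < R)
    (hcol : clusterColour u R (clusterOf T R x) = clusterColour u R (clusterOf T R y)) :
    attachingCluster (wordLength T) R (clusterOf T R x) =
      attachingCluster (wordLength T) R (clusterOf T R y) := by
  have hA := closure_coprodGenerators hS hT
  by_cases hx : (clusterOf T R x).2 ≤ R
  · exact attachingCluster_eq_of_depth_le hS hT hn hxy hcol hx
  by_cases hy : (clusterOf T R y).2 ≤ R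
  · refine (attachingCluster_eq_of_depth_le hS hT hn ?_ hcol.symm hy).symm
    rwa [← wordLength_inv hA, mul_inv_rev, inv_inv]
  have key := geodesic_induction hA (x := x) (y := y)
    (fun m z => ((clusterOf T R z).1 = (clusterOf T R x).1 ∧ R < (clusterOf T R z).2 + m) ∨
      (parentCluster (wordLength T) R (clusterOf T R z).1 = (clusterOf T R x).1 ∧
        (clusterOf T R z).2 ≤ m))
    (.inl ⟨rfl, not_le.mp hx⟩)
    (fun m z a hm ha hz => (clusterAdj_clusterOf hT R z ha).outer_step (hm.trans hxy) hz)
  rw [attachingCluster, attachingCluster, if_neg hx, if_neg hy]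
  rcases key with ⟨h₁, -⟩ | ⟨-, h₂⟩
  · exact h₁.symm
  · lia

/-- A geodesic from the inner half of a cluster either projects to a coset of `H` or meets the
parent cluster. -/
theorem sibling_or_exists_parent (hS : Subgroup.closure S = ⊤)
    (hT : Subgroup.closure T = ⊤) {R : ℕ} {x y : Monoid.Coprod G H}
    (hxy : wordLength (coprodGenerators S T) (x⁻¹ * y) < R) (hx : (clusterOf T R x).2 ≤ R) :
    ((clusterOf T R x).1.2 = (clusterOf T R y).1.2 ∧
      wordDist T (clusterOf T R x).1.1 (clusterOf T R y).1.1 ≤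
        wordDist (coprodGenerators S T) x y) ∨
    ∃ w, wordDist (coprodGenerators S T) x w ≤ wordDist (coprodGenerators S T) x y ∧
      (clusterOf T R w).1 = parentCluster (wordLength T) R (clusterOf T R x).1 := by
  have hA := closure_coprodGenerators hS hT
  have key := geodesic_induction hA (x := x) (y := y)
    (fun m z => wordLength (coprodGenerators S T) (x⁻¹ * z) ≤ m ∧
      (((clusterOf T R z).1.2 = (clusterOf T R x).1.2 ∧
        wordLength T ((clusterOf T R x).1.1⁻¹ * (clusterOf T R z).1.1) ≤ m ∧
        (clusterOf T R z).2 ≤ R + m) ∨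
      ∃ w, wordLength (coprodGenerators S T) (x⁻¹ * w) ≤ m ∧
        (clusterOf T R w).1 = parentCluster (wordLength T) R (clusterOf T R x).1))
    (by simpa using .inl hx) ?_
  · rcases key.2 with ⟨h₁, h₂, -⟩ | ⟨w, h₁, h₂⟩
    · exact .inl ⟨h₁.symm, Nat.cast_le.mpr h₂⟩
    · exact .inr ⟨w, Nat.cast_le.mpr h₁, h₂⟩
  · rintro m z a hm ha ⟨hz, hz'⟩
    have hza : wordLength (coprodGenerators S T) (x⁻¹ * (z * a)) ≤ m + 1 := by
      rw [← mul_assoc]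
      exact (wordLength_mul_le hA _ _).trans (add_le_add hz (wordLength_le_one ha))
    refine ⟨hza, ?_⟩
    rcases hz' with hz' | ⟨w, h₁, h₂⟩
    · rcases (clusterAdj_clusterOf hT R z ha).sibling_step (wordLength_mul_le hT)
        (hm.trans hxy) hz' with h | h
      exacts [.inl h, .inr ⟨_, hza, h⟩]
    · exact .inr ⟨w, by lia, h₂⟩

/-- A chain of one colour either projects to a chain in a coset of `H`, so that its endpoints are
close, or starts close to the cluster to which its first point is attached. -/
theorem wordDist_le_or_wordDist_attachingCluster_le (hS : Subgroup.closure S = ⊤)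
    (hT : Subgroup.closure T = ⊤) {n : ℕ} (hn : n ≠ 0) {s M : ℝ} {U : Fin (n + 1) → Set H}
    {u : H → Fin (n + 1)} (hu : ∀ h, h ∈ U (u h))
    (hU : ∀ i h k, IsDChain (wordDist T) s (U i) h k → wordDist T h k ≤ M)
    {R : ℕ} (hs : 0 < s) (hR : s ≤ R) {D : ℝ}
    (hD : ∀ x : Monoid.Coprod G H,
      wordDist (coprodGenerators S T) x (decode (clusterOf T R x).1) ≤ D)
    {i : Fin (n + 1)} {x y : Monoid.Coprod G H}
    (h : IsDChain (wordDist (coprodGenerators S T)) s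
      {z | clusterColour u R (clusterOf T R z) = i} x y) :
    wordDist (coprodGenerators S T) x y ≤ 2 * D + M ∨
      wordDist (coprodGenerators S T) x
        (decode (attachingCluster (wordLength T) R (clusterOf T R x))) ≤ 3 * D + M + s := by
  have hA := closure_coprodGenerators hS hT
  have triangle := wordDist_triangle hA
  have hM : 0 ≤ M := le_trans (Nat.cast_nonneg _) (hU (u 1) 1 1 (.refl (hu 1)))
  have hx₀ : clusterColour u R (clusterOf T R x) = i := h.mem_left
  have hD₀ : 0 ≤ D := le_trans (Nat.cast_nonneg _) (hD x)
  by_cases hx : (clusterOf T R x).2 ≤ R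
  swap
  · right
    rw [attachingCluster, if_neg hx]
    linarith [hD x]
  set P := attachingCluster (wordLength T) R (clusterOf T R x) with hP
  rw [attachingCluster, if_pos hx] at hP
  have dist_le : ∀ z, (clusterOf T R x).1.2 = (clusterOf T R z).1.2 →
      IsDChain (wordDist T) s (U i) (clusterOf T R x).1.1 (clusterOf T R z).1.1 →
      wordDist (coprodGenerators S T) x z ≤ 2 * D + M := by
    intro z h₁ h₂
    have h₃ := hU _ _ _ h₂
    rw [← wordDist_decode hS hT h₁] at h₃
    have h₄ := hD z
    rw [wordDist_comm hA] at h₄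
    linarith [hD x, triangle x (decode (clusterOf T R x).1) z,
      triangle (decode (clusterOf T R x).1) (decode (clusterOf T R z).1) z]
  have colour_mem : ∀ z : Monoid.Coprod G H, clusterColour u R (clusterOf T R z) = i →
      (clusterOf T R z).2 ≤ R → (clusterOf T R z).1.1 ∈ U i := by
    rintro z rfl hz
    rw [clusterColour, if_pos hz]
    exact hu _
  suffices ((clusterOf T R y).2 ≤ R ∧ (clusterOf T R x).1.2 = (clusterOf T R y).1.2 ∧
      IsDChain (wordDist T) s (U i) (clusterOf T R x).1.1 (clusterOf T R y).1.1) ∨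
      wordDist (coprodGenerators S T) x (decode P) ≤ 3 * D + M + s from
    this.imp_left fun h => dist_le y h.2.1 h.2.2
  refine h.induction (P := fun y => ((clusterOf T R y).2 ≤ R ∧
      (clusterOf T R x).1.2 = (clusterOf T R y).1.2 ∧
      IsDChain (wordDist T) s (U i) (clusterOf T R x).1.1 (clusterOf T R y).1.1) ∨ _)
    (.inl ⟨hx, rfl, .refl (colour_mem x hx₀ hx)⟩) ?_
  rintro a b ha hb hab (⟨ha₁, ha₂, ha₃⟩ | hclose)
  swap
  · exact .inr hclose
  have hlt : wordLength (coprodGenerators S T) (a⁻¹ * b) < R := by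
    exact Nat.cast_lt.mp (hab.trans_le hR)
  have hparent : parentCluster (wordLength T) R (clusterOf T R a).1 = P :=
    (parentCluster_congr ha₂.symm).trans hP.symm
  have close : ∀ w, wordDist (coprodGenerators S T) a w ≤ wordDist (coprodGenerators S T) a b →
      (clusterOf T R w).1 = P →
      wordDist (coprodGenerators S T) x (decode P) ≤ 3 * D + M + s := by
    intro w h₁ h₂
    have h₃ := hD w
    rw [h₂] at h₃
    linarith [dist_le a ha₂ ha₃, triangle x a (decode P), triangle a w (decode P)]
  by_cases hb₁ : (clusterOf T R b).2 ≤ R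
  · rcases sibling_or_exists_parent hS hT hlt ha₁ with ⟨h₁, h₂⟩ | ⟨w, h₁, h₂⟩
    · exact .inl ⟨hb₁, ha₂.trans h₁, ha₃.snoc (colour_mem b hb hb₁) (h₂.trans_lt hab)⟩
    · exact .inr (close w h₁ (h₂.trans hparent))
  · have hatt := attachingCluster_eq hS hT hn hlt (ha.mem_right.trans hb.symm)
    rw [attachingCluster, attachingCluster, if_pos ha₁, if_neg hb₁, hparent] at hatt
    exact .inr (close b le_rfl hatt.symm)

theorem dimLeAtScale_coprod (hS : Subgroup.closure S = ⊤) (hT : Subgroup.closure T = ⊤)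
    {K : ℕ} (hK : ∀ g : G, wordLength (coprodGenerators S T) (inl g) ≤ K)
    {n : ℕ} (hn : n ≠ 0) {s M : ℝ} (hs : 0 < s) (h : DimLeAtScale (wordDist T) n s M) :
    DimLeAtScale (wordDist (coprodGenerators S T)) n s
      (6 * ((K + 1) * (2 * ⌈s⌉₊) + K) + 2 * M + 2 * s) := by
  have hA := closure_coprodGenerators hS hT
  have hcomm := wordDist_comm hA
  obtain ⟨U, hcover, hU⟩ := (dimLeAtScale_iff (wordDist_comm hT)).mp h
  choose u hu using hcover
  have hD := wordDist_decode_clusterOf_le hS hT hK ⌈s⌉₊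
  set D : ℝ := (K + 1) * (2 * ⌈s⌉₊) + K
  have hD₀ : 0 ≤ D := by positivity
  have hM : 0 ≤ M := le_trans (Nat.cast_nonneg _) (hU (u 1) 1 1 (.refl (hu 1)))
  refine (dimLeAtScale_iff hcomm).mpr
    ⟨fun i => {z | clusterColour u ⌈s⌉₊ (clusterOf T ⌈s⌉₊ z) = i}, fun y => ⟨_, rfl⟩, ?_⟩
  intro i x y hxy
  have hatt : attachingCluster (wordLength T) ⌈s⌉₊ (clusterOf T ⌈s⌉₊ x) =
      attachingCluster (wordLength T) ⌈s⌉₊ (clusterOf T ⌈s⌉₊ y) := by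
    refine hxy.induction (P := fun y => _ = attachingCluster _ _ (clusterOf T ⌈s⌉₊ y)) rfl ?_
    intro a b ha hb hab ih
    refine ih.trans (attachingCluster_eq hS hT hn ?_ (ha.mem_right.trans hb.symm))
    exact Nat.cast_lt.mp (hab.trans_le (Nat.le_ceil s))
  rcases wordDist_le_or_wordDist_attachingCluster_le hS hT hn hu hU hs (Nat.le_ceil s) hD hxy
    with h₁ | h₁
  · linarith
  rcases wordDist_le_or_wordDist_attachingCluster_le hS hT hn hu hU hs (Nat.le_ceil s) hD
      (hxy.symm hcomm) with h₂ | h₂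
  · rw [hcomm] at h₂
    linarith
  rw [hcomm, ← hatt] at h₂
  linarith [wordDist_triangle hA x
    (decode (attachingCluster (wordLength T) ⌈s⌉₊ (clusterOf T ⌈s⌉₊ x))) y]

theorem ANdimLe.coprod [Finite G] (hS : Subgroup.closure S = ⊤) (hT : Subgroup.closure T = ⊤)
    {n : ℕ} (hn : n ≠ 0) (h : ANdimLe (wordDist T) n) :
    ANdimLe (wordDist (coprodGenerators S T)) n := by
  obtain ⟨K, hK⟩ := (Set.finite_range
    fun g : G => wordLength (coprodGenerators S T) (inl g)).bddAbove
  obtain ⟨C, b, hC, hb, h⟩ := h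
  refine ⟨12 * (K + 1) + 2 * C + 2, 12 * (K + 1) + 6 * K + 2 * b, by positivity, by positivity,
    fun s hs => ?_⟩
  obtain ⟨U, hcover, hU⟩ :=
    dimLeAtScale_coprod hS hT (fun g => hK ⟨g, rfl⟩) hn hs (h s hs)
  refine ⟨U, hcover, fun i C' hC' x hx y hy => (hU i C' hC' x hx y hy).trans ?_⟩
  have hceil := (Nat.ceil_lt_add_one hs.le).le
  have : (K + 1 : ℝ) * ⌈s⌉₊ ≤ (K + 1) * (s + 1) := by gcongr
  dsimp only
  linarith

end FreeProduct

/-- If `G` is a finite group and `H` a finitely generated infinite group, then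
`asdim_AN (G ∗ H) = asdim_AN H` (for the word metrics). -/
theorem asdimAN_freeProduct_finite_factor (G H : Type*) [Group G] [Group H]
    [Finite G] [Infinite H]
    (S : Set G) (T : Set H) (hSfin : S.Finite) (hTfin : T.Finite)
    (hSgen : Subgroup.closure S = ⊤) (hTgen : Subgroup.closure T = ⊤) :
    asdimAN (wordDist
        ((⇑(Monoid.Coprod.inl : G →* Monoid.Coprod G H) '' S) ∪
          (⇑(Monoid.Coprod.inr : H →* Monoid.Coprod G H) '' T))) =
      asdimAN (wordDist T) := by
  have hA := closure_coprodGenerators hSgen hTgen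
  refine congrArg sInf (Set.ext fun N => exists_congr fun n => and_congr_right fun _ =>
    ⟨fun h => h.of_isometry (wordDist_comm hA) Monoid.Coprod.inr (wordDist_inr hSgen hTgen),
      fun h => h.coprod hSgen hTgen ?_⟩)
  rintro rfl
  exact not_aNdimLe_zero hTgen hTfin h
end

section
/- Let X be a complete geodesic metric space and 𝒫 a collection of closed geodesic subsets covering X such that every two different members of 𝒫 intersect in at most one point (condition (T₁)). Then X satisfies condition (T₂'') (every simple loop in X is contained in one piece) if and only if X satisfies condition (T'₂): for every topological arc C : [0, d] → X and every t ∈ [0, d], if C[t − a, t + b] is a maximal sub-arc of C containing C(t) and contained in one piece, then every other topological arc in X with the same endpoints as C must contain the points C(t − a) and C(t + b). -/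
open Set Metric

section Core

variable {X : Type*} [MetricSpace X]

/-- A geodesic segment parametrized by the interval `[a, b]`:
an isometric embedding of `[a, b]` into `X`. -/
def IsGeodesicSegment (γ : ℝ → X) (a b : ℝ) : Prop :=
  ∀ s ∈ Set.Icc a b, ∀ t ∈ Set.Icc a b, dist (γ s) (γ t) = |s - t|

/-- A metric space is geodesic if every two points are joined by a geodesic. -/
def GeodesicSpace (X : Type*) [MetricSpace X] : Prop :=
  ∀ x y : X, ∃ γ : ℝ → X, IsGeodesicSegment γ 0 (dist x y) ∧ γ 0 = x ∧ γ (dist x y) = y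

/-- A subset is geodesic if every two of its points are joined by a geodesic of `X`
contained in the subset. -/
def IsGeodesicSubset (S : Set X) : Prop :=
  ∀ x ∈ S, ∀ y ∈ S, ∃ γ : ℝ → X, IsGeodesicSegment γ 0 (dist x y) ∧ γ 0 = x ∧
    γ (dist x y) = y ∧ ∀ t ∈ Set.Icc (0 : ℝ) (dist x y), γ t ∈ S

/-- A (complete geodesic) metric space is tree-graded with respect to a collection `PX`
of closed geodesic subsets (pieces) covering `X` if every two different pieces meet in
at most one point (T₁) and every simple loop (injective continuous image of a circle)
is contained in one piece (T₂''). -/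
structure IsTreeGraded (X : Type*) [MetricSpace X] (PX : Set (Set X)) : Prop where
  nonempty : ∀ P ∈ PX, P.Nonempty
  closed : ∀ P ∈ PX, IsClosed P
  geodesicSub : ∀ P ∈ PX, IsGeodesicSubset P
  covers : ∀ x : X, ∃ P ∈ PX, x ∈ P
  t1 : ∀ P ∈ PX, ∀ Q ∈ PX, P ≠ Q → (P ∩ Q).Subsingleton
  t2 : ∀ loop : AddCircle (1 : ℝ) → X, Continuous loop → Function.Injective loop →
    ∃ P ∈ PX, Set.range loop ⊆ P

end Core
/-- Condition (T₂''): every simple loop in `X` is contained in one piece. -/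
def CondT2'' (X : Type*) [MetricSpace X] (PX : Set (Set X)) : Prop :=
  ∀ loop : AddCircle (1 : ℝ) → X, Continuous loop → Function.Injective loop →
    ∃ P ∈ PX, Set.range loop ⊆ P

/-- Condition (T₂'): for every topological arc `C : [0, d] → X` and every `t ∈ [0, d]`,
if `C [t - a, t + b]` is a maximal sub-arc of `C` containing `C t` and contained in one
piece, then every other topological arc with the same endpoints as `C` contains the
points `C (t - a)` and `C (t + b)`. -/
def CondT2' (X : Type*) [MetricSpace X] (PX : Set (Set X)) : Prop :=
  ∀ (d : ℝ) (C : ℝ → X), 0 ≤ d → ContinuousOn C (Set.Icc 0 d) →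
    Set.InjOn C (Set.Icc 0 d) →
  ∀ t ∈ Set.Icc (0 : ℝ) d, ∀ a b : ℝ, 0 ≤ a → 0 ≤ b →
    t - a ∈ Set.Icc (0 : ℝ) d → t + b ∈ Set.Icc (0 : ℝ) d →
    (∃ P ∈ PX, C '' Set.Icc (t - a) (t + b) ⊆ P) →
    (∀ a' b' : ℝ, 0 ≤ a' → 0 ≤ b' → t - a' ∈ Set.Icc (0 : ℝ) d →
      t + b' ∈ Set.Icc (0 : ℝ) d →
      (∃ P ∈ PX, C '' Set.Icc (t - a') (t + b') ⊆ P) →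
      Set.Icc (t - a) (t + b) ⊆ Set.Icc (t - a') (t + b') → a = a' ∧ b = b') →
    ∀ (d' : ℝ) (C' : ℝ → X), 0 ≤ d' → ContinuousOn C' (Set.Icc 0 d') →
      Set.InjOn C' (Set.Icc 0 d') → C' 0 = C 0 → C' d' = C d →
      C (t - a) ∈ C' '' Set.Icc 0 d' ∧ C (t + b) ∈ C' '' Set.Icc 0 d'

/-- Two arcs that share exactly their endpoints form a simple loop. -/
theorem exists_loop_of_arcs {X : Type*} [TopologicalSpace X] {f g : ℝ → X}
    (hf : ContinuousOn f (Icc 0 1)) (hg : ContinuousOn g (Icc 0 1))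
    (hfi : InjOn f (Icc 0 1)) (hgi : InjOn g (Icc 0 1))
    (h0 : f 0 = g 0) (h1 : f 1 = g 1)
    (hfg : ∀ x ∈ Ioo (0 : ℝ) 1, ∀ y ∈ Icc (0 : ℝ) 1, f x ≠ g y) :
    ∃ loop : AddCircle (1 : ℝ) → X, Continuous loop ∧ Function.Injective loop ∧
      f '' Icc 0 1 ⊆ range loop := by
  set h : ℝ → X := fun x => if x ≤ 1 / 2 then f (2 * x) else g (2 - 2 * x)
  have hl : ∀ x ≤ (1 / 2 : ℝ), h x = f (2 * x) := fun x hx => if_pos hx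
  have hr : ∀ x ≥ (1 / 2 : ℝ), h x = g (2 - 2 * x) := by
    intro x hx
    rcases hx.eq_or_lt with rfl | hx
    · rw [hl _ le_rfl]; norm_num [h1]
    · exact if_neg (not_le.2 hx)
  have hc : ContinuousOn h (Icc 0 1) := by
    rw [← Icc_union_Icc_eq_Icc (show (0 : ℝ) ≤ 1 / 2 by norm_num)
      (show (1 / 2 : ℝ) ≤ 1 by norm_num)]
    refine ContinuousOn.union_of_isClosed ?_ ?_ isClosed_Icc isClosed_Icc
    · refine ContinuousOn.congr (f := f ∘ fun x => 2 * x) ?_ fun x hx => hl x hx.2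
      refine hf.comp (by fun_prop) fun x hx => ?_
      constructor <;> linarith [hx.1, hx.2]
    · refine ContinuousOn.congr (f := g ∘ fun x => 2 - 2 * x) ?_ fun x hx => hr x hx.1
      refine hg.comp (by fun_prop) fun x hx => ?_
      constructor <;> linarith [hx.1, hx.2]
  have hends : h 0 = h 1 := by
    rw [hl 0 (by norm_num), hr 1 (by norm_num)]; norm_num [h0]
  have hcross : ∀ x ∈ Ico (0 : ℝ) 1, ∀ y ∈ Ico (0 : ℝ) 1, x ≤ 1 / 2 → 1 / 2 < y →
      h x ≠ h y := by
    intro x hx y hy hx2 hy2 hxy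
    rw [hl x hx2, hr y hy2.le] at hxy
    have hy' : 2 - 2 * y ∈ Icc (0 : ℝ) 1 := by constructor <;> linarith [hy.2]
    rcases hx.1.eq_or_lt with rfl | hx0
    · rw [mul_zero, h0] at hxy
      have := hgi (by simp) hy' hxy
      linarith [hy.2]
    rcases hx2.eq_or_lt with rfl | hx2
    · rw [show 2 * (1 / 2 : ℝ) = 1 by norm_num, h1] at hxy
      have := hgi (by simp) hy' hxy
      linarith
    · exact hfg _ ⟨by linarith, by linarith⟩ _ hy' hxy
  have hinj : InjOn h (Ico 0 1) := by
    intro x hx y hy hxy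
    rcases le_or_gt x (1 / 2) with hx2 | hx2 <;> rcases le_or_gt y (1 / 2) with hy2 | hy2
    · rw [hl x hx2, hl y hy2] at hxy
      have := hfi ⟨by linarith [hx.1], by linarith⟩ ⟨by linarith [hy.1], by linarith⟩ hxy
      linarith
    · exact (hcross x hx y hy hx2 hy2 hxy).elim
    · exact (hcross y hy x hx hy2 hx2 hxy.symm).elim
    · rw [hr x hx2.le, hr y hy2.le] at hxy
      have := hgi ⟨by linarith [hx.2], by linarith⟩ ⟨by linarith [hy.2], by linarith⟩ hxy
      linarith
  have : Fact ((0 : ℝ) < 1) := ⟨one_pos⟩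
  refine ⟨AddCircle.liftIco 1 0 h, AddCircle.liftIco_zero_continuous hends hc, ?_, ?_⟩
  · intro u v huv
    obtain ⟨x, hx, rfl⟩ : u ∈ ((↑) : ℝ → AddCircle (1 : ℝ)) '' Ico 0 (0 + 1) := by
      rw [AddCircle.coe_image_Ico_eq]; trivial
    obtain ⟨y, hy, rfl⟩ : v ∈ ((↑) : ℝ → AddCircle (1 : ℝ)) '' Ico 0 (0 + 1) := by
      rw [AddCircle.coe_image_Ico_eq]; trivial
    rw [zero_add] at hx hy
    rw [AddCircle.liftIco_zero_coe_apply hx, AddCircle.liftIco_zero_coe_apply hy] at huv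
    rw [hinj hx hy huv]
  · rintro _ ⟨x, hx, rfl⟩
    refine ⟨((x / 2 : ℝ) : AddCircle (1 : ℝ)), ?_⟩
    rw [AddCircle.liftIco_zero_coe_apply ⟨by linarith [hx.1], by linarith [hx.2]⟩,
      hl _ (by linarith [hx.2])]
    congr 1; ring

/-- Under (T₂''), an interior point of an arc `C` which is missed by another arc `C'` with the
same endpoints lies in the interior of a sub-arc of `C` contained in one piece. -/
theorem CondT2''.exists_subarc {X : Type*} [MetricSpace X] {PX : Set (Set X)}
    (h2 : CondT2'' X PX) {d : ℝ} {C : ℝ → X}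
    (hC : ContinuousOn C (Icc 0 d)) (hCi : InjOn C (Icc 0 d))
    {d' : ℝ} {C' : ℝ → X} (hd' : 0 ≤ d') (hC' : ContinuousOn C' (Icc 0 d'))
    (hCi' : InjOn C' (Icc 0 d')) (h0 : C' 0 = C 0) (h1 : C' d' = C d)
    {r : ℝ} (hr : r ∈ Icc 0 d) (hrC : C r ∉ C' '' Icc 0 d') :
    ∃ u v : ℝ, 0 ≤ u ∧ u < r ∧ r < v ∧ v ≤ d ∧ ∃ P ∈ PX, C '' Icc u v ⊆ P := by
  have hK : IsClosed (C' '' Icc 0 d') := (isCompact_Icc.image_of_continuousOn hC').isClosed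
  have hS : IsCompact (Icc 0 d ∩ C ⁻¹' (C' '' Icc 0 d')) :=
    isCompact_Icc.of_isClosed_subset (hC.preimage_isClosed_of_isClosed isClosed_Icc hK)
      inter_subset_left
  have h0d : (0 : ℝ) ≤ d := hr.1.trans hr.2
  obtain ⟨u, ⟨⟨hud, u', hu', huC⟩, hur⟩, humax⟩ := (hS.inter_right (isClosed_Iic (a := r))).exists_isGreatest
    ⟨0, ⟨left_mem_Icc.2 h0d, 0, left_mem_Icc.2 hd', h0⟩, hr.1⟩
  obtain ⟨v, ⟨⟨hvd, v', hv', hvC⟩, hvr⟩, hvmin⟩ := (hS.inter_right (isClosed_Ici (a := r))).exists_isLeast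
    ⟨d, ⟨right_mem_Icc.2 h0d, d', right_mem_Icc.2 hd', h1⟩, hr.2⟩
  rw [mem_Iic] at hur
  rw [mem_Ici] at hvr
  replace hur : u < r := hur.lt_of_ne fun h => hrC (h ▸ ⟨u', hu', huC⟩)
  replace hvr : r < v := hvr.lt_of_ne fun h => hrC (h ▸ ⟨v', hv', hvC⟩)
  have huv : u < v := hur.trans hvr
  have huv' : u' ≠ v' := by
    rintro rfl
    exact huv.ne (hCi hud hvd (huC.symm.trans hvC))
  have hmaps : ∀ {a b : ℝ} {s : Set ℝ}, Convex ℝ s → a ∈ s → b ∈ s →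
      MapsTo (AffineMap.lineMap a b : ℝ → ℝ) (Icc 0 1) s :=
    fun hs ha hb x hx => hs.lineMap_mem ha hb hx
  have hmapsC := hmaps (convex_Icc 0 d) hud hvd
  have hmapsC' := hmaps (convex_Icc 0 d') hu' hv'
  obtain ⟨loop, hlc, hli, hlr⟩ := exists_loop_of_arcs
    (f := C ∘ AffineMap.lineMap u v) (g := C' ∘ AffineMap.lineMap u' v')
    (hC.comp AffineMap.lineMap_continuous.continuousOn hmapsC)
    (hC'.comp AffineMap.lineMap_continuous.continuousOn hmapsC')
    (hCi.comp (AffineMap.lineMap_injective ℝ huv.ne).injOn hmapsC)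
    (hCi'.comp (AffineMap.lineMap_injective ℝ huv').injOn hmapsC')
    (by simp [huC]) (by simp [hvC]) (by
      intro x hx y hy hxy
      set z : ℝ := AffineMap.lineMap u v x with hz
      have hzS : z ∈ Icc 0 d ∩ C ⁻¹' (C' '' Icc 0 d') :=
        ⟨hmapsC (Ioo_subset_Icc_self hx), _, hmapsC' hy, hxy.symm⟩
      have hz' : z = u + x * (v - u) := by
        rw [hz, AffineMap.lineMap_apply_module']; simp [add_comm]
      rcases le_total z r with h | h
      · nlinarith [humax ⟨hzS, h⟩, mul_pos hx.1 (sub_pos.2 huv)]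
      · nlinarith [hvmin ⟨hzS, h⟩, mul_pos (sub_pos.2 hx.2) (sub_pos.2 huv)])
  obtain ⟨P, hP, hloop⟩ := h2 loop hlc hli
  refine ⟨u, v, hud.1, hur, hvr, hvd.2, P, hP, ?_⟩
  rw [← segment_eq_Icc huv.le, segment_eq_image_lineMap, ← image_comp]
  exact hlr.trans hloop

/-- Every point of an arc lies in a maximal sub-arc contained in one piece. -/
theorem exists_maximal_subarc {X : Type*} [MetricSpace X] {PX : Set (Set X)}
    (hclosed : ∀ P ∈ PX, IsClosed P) (hcovers : ∀ x : X, ∃ P ∈ PX, x ∈ P)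
    (ht1 : ∀ P ∈ PX, ∀ Q ∈ PX, P ≠ Q → (P ∩ Q).Subsingleton)
    {d : ℝ} {C : ℝ → X} (hC : ContinuousOn C (Icc 0 d)) (hCi : InjOn C (Icc 0 d))
    {t : ℝ} (ht : t ∈ Icc 0 d) :
    ∃ u v : ℝ, 0 ≤ u ∧ u ≤ t ∧ t ≤ v ∧ v ≤ d ∧ (∃ P ∈ PX, C '' Icc u v ⊆ P) ∧
      ∀ u' v' : ℝ, 0 ≤ u' → u' ≤ u → v ≤ v' → v' ≤ d → (∃ P ∈ PX, C '' Icc u' v' ⊆ P) →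
        u' = u ∧ v' = v := by
  by_cases hex : ∃ u₀ v₀ : ℝ, 0 ≤ u₀ ∧ u₀ ≤ t ∧ t ≤ v₀ ∧ v₀ ≤ d ∧ u₀ < v₀ ∧
      ∃ P ∈ PX, C '' Icc u₀ v₀ ⊆ P
  · obtain ⟨u₀, v₀, hu₀, hut, htv, hv₀, huv₀, P, hP, hCP⟩ := hex
    set K := Icc 0 d ∩ C ⁻¹' P
    have hKc : IsClosed K := hC.preimage_isClosed_of_isClosed isClosed_Icc (hclosed P hP)
    have hsub : ∀ {u v : ℝ}, 0 ≤ u → v ≤ d → C '' Icc u v ⊆ P → Icc u v ⊆ K :=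
      fun hu hv h x hx => ⟨⟨hu.trans hx.1, hx.2.trans hv⟩, h (mem_image_of_mem C hx)⟩
    have htK : t ∈ K := hsub hu₀ hv₀ hCP ⟨hut, htv⟩
    set J := connectedComponentIn K t
    have hJK : J ⊆ K := connectedComponentIn_subset K t
    have htJ : t ∈ J := mem_connectedComponentIn htK
    have hJp : IsPreconnected J := isPreconnected_connectedComponentIn
    have hJc : IsClosed J := closure_subset_iff_isClosed.1
      (hJp.closure.subset_connectedComponentIn (subset_closure htJ) (closure_minimal hJK hKc))
    have hJI : J = Icc (sInf J) (sSup J) := eq_Icc_of_connected_compact ⟨⟨t, htJ⟩, hJp⟩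
      (isCompact_Icc.of_isClosed_subset hJc (hJK.trans inter_subset_left))
    set u := sInf J
    set v := sSup J
    rw [hJI] at htJ hJK
    have hu := hJK (left_mem_Icc.2 (htJ.1.trans htJ.2))
    have hv := hJK (right_mem_Icc.2 (htJ.1.trans htJ.2))
    have hmax : ∀ {u' v' : ℝ}, 0 ≤ u' → u' ≤ t → t ≤ v' → v' ≤ d → C '' Icc u' v' ⊆ P →
        u ≤ u' ∧ v' ≤ v := by
      intro u' v' hu' hut' htv' hv' h
      have : Icc u' v' ⊆ Icc u v := hJI ▸
        isPreconnected_Icc.subset_connectedComponentIn ⟨hut', htv'⟩ (hsub hu' hv' h)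
      exact (Icc_subset_Icc_iff (hut'.trans htv')).1 this
    have h₀ := hmax hu₀ hut htv hv₀ hCP
    refine ⟨u, v, hu.1.1, htJ.1, htJ.2, hv.1.2, ⟨P, hP, image_subset_iff.2 fun x hx => (hJK hx).2⟩,
      ?_⟩
    rintro u' v' hu' huu hvv hv' ⟨Q, hQ, hCQ⟩
    have hPQ : Q = P := by
      by_contra hne
      have hmem : ∀ x ∈ Icc u₀ v₀, C x ∈ Q ∩ P := fun x hx =>
        ⟨hCQ (mem_image_of_mem C ⟨by linarith [hx.1], by linarith [hx.2]⟩),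
          hCP (mem_image_of_mem C hx)⟩
      exact huv₀.ne (hCi ⟨hu₀, hut.trans ht.2⟩ ⟨ht.1.trans htv, hv₀⟩
        (ht1 Q hQ P hP hne (hmem _ (left_mem_Icc.2 huv₀.le)) (hmem _ (right_mem_Icc.2 huv₀.le))))
    obtain ⟨h₁, h₂⟩ := hmax hu' (huu.trans htJ.1) (htJ.2.trans hvv) hv' (hPQ ▸ hCQ)
    exact ⟨huu.antisymm h₁, h₂.antisymm hvv⟩
  · obtain ⟨P, hP, htP⟩ := hcovers (C t)
    refine ⟨t, t, ht.1, le_rfl, le_rfl, ht.2, ⟨P, hP, by simpa using htP⟩, ?_⟩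
    intro u' v' hu' hut htv hv' hP'
    have : v' ≤ u' := not_lt.1 fun h => hex ⟨u', v', hu', hut, htv, hv', h, hP'⟩
    exact ⟨by linarith, by linarith⟩

/-- Under (T₂'), an arc is contained in one piece as soon as another arc with the same endpoints
meets it in these endpoints only. -/
theorem CondT2'.subset_piece {X : Type*} [MetricSpace X] {PX : Set (Set X)}
    (h2 : CondT2' X PX) (hclosed : ∀ P ∈ PX, IsClosed P) (hcovers : ∀ x : X, ∃ P ∈ PX, x ∈ P)
    (ht1 : ∀ P ∈ PX, ∀ Q ∈ PX, P ≠ Q → (P ∩ Q).Subsingleton)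
    {d : ℝ} (hd : 0 < d) {C : ℝ → X} (hC : ContinuousOn C (Icc 0 d)) (hCi : InjOn C (Icc 0 d))
    {d' : ℝ} (hd' : 0 ≤ d') {C' : ℝ → X} (hC' : ContinuousOn C' (Icc 0 d'))
    (hCi' : InjOn C' (Icc 0 d')) (h0 : C' 0 = C 0) (h1 : C' d' = C d)
    (hCC' : ∀ s ∈ Icc 0 d, C s ∈ C' '' Icc 0 d' → s = 0 ∨ s = d) :
    ∃ P ∈ PX, C '' Icc 0 d ⊆ P := by
  have ht : d / 2 ∈ Icc 0 d := ⟨by linarith, by linarith⟩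
  obtain ⟨u, v, hu, hut, htv, hv, hP, hmax⟩ :=
    exists_maximal_subarc hclosed hcovers ht1 hC hCi ht
  have hud : u ∈ Icc 0 d := ⟨hu, hut.trans ht.2⟩
  have hvd : v ∈ Icc 0 d := ⟨ht.1.trans htv, hv⟩
  obtain ⟨hCu, hCv⟩ := h2 d C hd.le hC hCi (d / 2) ht (d / 2 - u) (v - d / 2) (sub_nonneg.2 hut)
    (sub_nonneg.2 htv) (by rwa [sub_sub_cancel]) (by rwa [add_sub_cancel])
    (by rwa [sub_sub_cancel, add_sub_cancel])
    (by
      intro a' b' _ _ ha' hb' hP' hsub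
      rw [sub_sub_cancel, add_sub_cancel, Icc_subset_Icc_iff (hut.trans htv)] at hsub
      obtain ⟨h, h'⟩ := hmax _ _ ha'.1 hsub.1 hsub.2 hb'.2 hP'
      exact ⟨by linarith, by linarith⟩)
    d' C' hd' hC' hCi' h0 h1
  rw [sub_sub_cancel] at hCu
  rw [add_sub_cancel] at hCv
  have hu0 : u = 0 := (hCC' u hud hCu).resolve_right fun h => by linarith
  have hvd : v = d := (hCC' v hvd hCv).resolve_left fun h => by linarith
  rwa [hu0, hvd] at hP

/-- Under (T₂'), two thirds of a simple loop are contained in one piece. -/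
theorem CondT2'.loop_subarc {X : Type*} [MetricSpace X] {PX : Set (Set X)}
    (h2 : CondT2' X PX) (hclosed : ∀ P ∈ PX, IsClosed P) (hcovers : ∀ x : X, ∃ P ∈ PX, x ∈ P)
    (ht1 : ∀ P ∈ PX, ∀ Q ∈ PX, P ≠ Q → (P ∩ Q).Subsingleton)
    {loop : AddCircle (1 : ℝ) → X} (hc : Continuous loop) (hi : Function.Injective loop)
    (x₀ : ℝ) :
    ∃ P ∈ PX, ∀ s ∈ Icc (0 : ℝ) (2 / 3), loop ((x₀ + s : ℝ) : AddCircle (1 : ℝ)) ∈ P := by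
  have hcoe : ∀ x y : ℝ, loop x = loop y → ∃ n : ℤ, x - y = n := by
    intro x y h
    have h' : ((x - y : ℝ) : AddCircle (1 : ℝ)) = 0 := by
      rw [AddCircle.coe_sub, hi h, sub_self]
    obtain ⟨n, hn⟩ := (AddCircle.coe_eq_zero_iff _).1 h'
    exact ⟨n, by simpa using hn.symm⟩
  have hzero : ∀ {x y : ℝ}, loop x = loop y → |x - y| < 1 → x = y := by
    intro x y h hxy
    obtain ⟨n, hn⟩ := hcoe x y h
    rw [hn] at hxy
    have : n = 0 := Int.abs_lt_one_iff.1 (by exact_mod_cast hxy)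
    rw [this, Int.cast_zero] at hn
    linarith
  have hcont : Continuous fun x : ℝ => loop x := hc.comp (AddCircle.continuous_mk' 1)
  obtain ⟨P, hP, h⟩ := h2.subset_piece hclosed hcovers ht1 (d := 2 / 3) (by norm_num)
    (C := fun s => loop ((x₀ + s : ℝ) : AddCircle (1 : ℝ)))
    (hcont.comp (continuous_const.add continuous_id)).continuousOn
    (by
      intro x hx y hy hxy
      have := hzero hxy (by rw [abs_lt]; constructor <;> linarith [hx.1, hx.2, hy.1, hy.2])
      linarith)
    (d' := 1 / 3) (by norm_num)
    (C' := fun s => loop ((x₀ - s : ℝ) : AddCircle (1 : ℝ)))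
    (hcont.comp (continuous_const.sub continuous_id)).continuousOn
    (by
      intro x hx y hy hxy
      have := hzero hxy (by rw [abs_lt]; constructor <;> linarith [hx.1, hx.2, hy.1, hy.2])
      linarith)
    (by simp)
    (by
      rw [← AddCircle.coe_add_period 1 (x₀ - 1 / 3)]
      congr 2
      ring)
    (by
      rintro s hs ⟨s', hs', h⟩
      by_cases hs1 : s + s' < 1
      · have := hzero h (by rw [abs_lt]; constructor <;> linarith [hs.1, hs'.1])
        left; linarith [hs.1, hs'.1]
      · right; linarith [hs.2, hs'.2])
  exact ⟨P, hP, fun s hs => h (mem_image_of_mem _ hs)⟩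

/-- In the definition of tree-graded spaces, condition (T₂'') can be replaced by
condition (T₂'): for a complete geodesic metric space `X` and a collection `PX` of
closed geodesic subsets covering `X` and satisfying (T₁), the conditions (T₂'') and
(T₂') are equivalent. -/
theorem condT2''_iff_condT2' (X : Type*) [MetricSpace X] [CompleteSpace X]
    (PX : Set (Set X)) (hgeo : GeodesicSpace X)
    (hne : ∀ P ∈ PX, P.Nonempty)
    (hclosed : ∀ P ∈ PX, IsClosed P)
    (hgeoSub : ∀ P ∈ PX, IsGeodesicSubset P)
    (hcovers : ∀ x : X, ∃ P ∈ PX, x ∈ P)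
    (ht1 : ∀ P ∈ PX, ∀ Q ∈ PX, P ≠ Q → (P ∩ Q).Subsingleton) :
    CondT2'' X PX ↔ CondT2' X PX := by
  constructor
  · intro h2 d C _ hC hCi t ht a b ha hb hta htb hP hmax d' C' hd' hC' hCi' h0 h1
    have key : ∀ r, r = t - a ∨ r = t + b → C r ∈ C' '' Icc 0 d' := by
      intro r hr_end
      have hr : r ∈ Icc (t - a) (t + b) := by
        rcases hr_end with rfl | rfl <;> constructor <;> linarith
      by_contra hrC
      obtain ⟨Q, hQ, hCQ⟩ := hP
      obtain ⟨u, v, hu, hur, hrv, hv, P, hP, hCP⟩ := h2.exists_subarc hC hCi hd' hC' hCi' h0 h1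
        ⟨hta.1.trans hr.1, hr.2.trans htb.2⟩ hrC
      have hlarge : ∃ R ∈ PX, C '' Icc (min u (t - a)) (max v (t + b)) ⊆ R := by
        rcases (hr.1.trans hr.2).eq_or_lt with heq | hlt
        · refine ⟨P, hP, ?_⟩
          rwa [min_eq_left (by linarith [hr.2]), max_eq_left (by linarith [hr.1])]
        have hPQ : P = Q := by
          by_contra hne
          have hmem : ∀ x, u ≤ x → x ≤ v → t - a ≤ x → x ≤ t + b → C x ∈ P ∩ Q :=
            fun x h₁ h₂ h₃ h₄ => ⟨hCP ⟨x, ⟨h₁, h₂⟩, rfl⟩, hCQ ⟨x, ⟨h₃, h₄⟩, rfl⟩⟩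
          have hlt' : max u (t - a) < min v (t + b) := by
            rw [max_lt_iff, lt_min_iff, lt_min_iff]
            exact ⟨⟨hur.trans hrv, hur.trans_le hr.2⟩, hr.1.trans_lt hrv, hlt⟩
          refine hlt'.ne (hCi ⟨le_max_of_le_left hu, hlt'.le.trans (min_le_of_left_le hv)⟩
            ⟨(le_max_of_le_left hu).trans hlt'.le, min_le_of_left_le hv⟩
            (ht1 P hP Q hQ hne (hmem _ ?_ ?_ ?_ ?_) (hmem _ ?_ ?_ ?_ ?_)))
          · exact le_max_left _ _
          · exact hlt'.le.trans (min_le_left _ _)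
          · exact le_max_right _ _
          · exact hlt'.le.trans (min_le_right _ _)
          · exact (le_max_left _ _).trans hlt'.le
          · exact min_le_left _ _
          · exact (le_max_right _ _).trans hlt'.le
          · exact min_le_right _ _
        subst hPQ
        refine ⟨P, hP, image_subset_iff.2 fun x hx => ?_⟩
        rcases le_total x r with hxr | hxr
        · rcases min_le_iff.1 hx.1 with h | h
          · exact hCP ⟨x, ⟨h, by linarith⟩, rfl⟩
          · exact hCQ ⟨x, ⟨h, hxr.trans hr.2⟩, rfl⟩
        · rcases le_max_iff.1 hx.2 with h | h
          · exact hCP ⟨x, ⟨by linarith, h⟩, rfl⟩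
          · exact hCQ ⟨x, ⟨hr.1.trans hxr, h⟩, rfl⟩
      have hmin := min_le_right u (t - a)
      have hmax' := le_max_right v (t + b)
      obtain ⟨h, h'⟩ := hmax (t - min u (t - a)) (max v (t + b) - t) (by linarith) (by linarith)
        (by rw [sub_sub_cancel]; exact ⟨le_min hu hta.1, hmin.trans hta.2⟩)
        (by rw [add_sub_cancel]; exact ⟨htb.1.trans hmax', max_le hv htb.2⟩)
        (by rwa [sub_sub_cancel, add_sub_cancel])
        (by rw [sub_sub_cancel, add_sub_cancel]; exact Icc_subset_Icc hmin hmax')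
      rcases hr_end with rfl | rfl
      · linarith [min_le_left u (t - a)]
      · linarith [le_max_left v (t + b)]
    exact ⟨key _ (Or.inl rfl), key _ (Or.inr rfl)⟩
  · intro h2 loop hc hi
    obtain ⟨P, hP, hloopP⟩ := h2.loop_subarc hclosed hcovers ht1 hc hi 0
    obtain ⟨Q, hQ, hloopQ⟩ := h2.loop_subarc hclosed hcovers ht1 hc hi (1 / 3)
    have hthird : ((1 / 3 : ℝ) : AddCircle (1 : ℝ)) ∈ loop ⁻¹' (P ∩ Q) := by
      refine ⟨?_, ?_⟩
      · simpa using hloopP (1 / 3) (by constructor <;> norm_num)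
      · simpa using hloopQ 0 (by constructor <;> norm_num)
    have htwo : ((2 / 3 : ℝ) : AddCircle (1 : ℝ)) ∈ loop ⁻¹' (P ∩ Q) := by
      refine ⟨?_, ?_⟩
      · simpa only [zero_add] using hloopP (2 / 3) (by constructor <;> norm_num)
      · have := hloopQ (1 / 3) (by constructor <;> norm_num)
        rwa [show (1 / 3 + 1 / 3 : ℝ) = 2 / 3 by norm_num] at this
    have hfact : Fact ((0 : ℝ) < 1) := ⟨one_pos⟩
    have hPQ : P = Q := by
      by_contra hne
      have h := (AddCircle.coe_eq_coe_iff_of_mem_Ico (p := (1 : ℝ)) (a := 0) (by norm_num)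
        (by norm_num)).1 (hi (ht1 P hP Q hQ hne hthird htwo))
      norm_num at h
    refine ⟨P, hP, ?_⟩
    rintro _ ⟨z, rfl⟩
    obtain ⟨x, hx, rfl⟩ : z ∈ ((↑) : ℝ → AddCircle (1 : ℝ)) '' Ico 0 (0 + 1) := by
      rw [AddCircle.coe_image_Ico_eq]; trivial
    rw [zero_add] at hx
    rcases le_total x (2 / 3) with h | h
    · simpa only [zero_add] using hloopP x ⟨hx.1, h⟩
    · have := hloopQ (x - 1 / 3) ⟨by linarith, by linarith [hx.2]⟩
      rwa [add_sub_cancel, ← hPQ] at this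
end

section
/- Let X be a tree-graded space with respect to a collection 𝒫 of pieces, let γ be a geodesic in X and let P be a piece. Then the intersection γ ∩ P is either empty, or a single point, or a closed subpath (subsegment) of γ. -/
open Set Metric

theorem IsGeodesicSegment.continuousOn {X : Type*} [MetricSpace X] {γ : ℝ → X} {a b : ℝ}
    (h : IsGeodesicSegment γ a b) : ContinuousOn γ (Set.Icc a b) := by
  have : LipschitzOnWith 1 γ (Set.Icc a b) :=
    LipschitzOnWith.of_dist_le_mul fun s hs t ht => by
      simp [h s hs t ht, Real.dist_eq]
  exact this.continuousOn

theorem IsGeodesicSegment.injOn {X : Type*} [MetricSpace X] {γ : ℝ → X} {a b : ℝ}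
    (h : IsGeodesicSegment γ a b) : Set.InjOn γ (Set.Icc a b) := by
  intro s hs t ht hst
  have := h s hs t ht
  rw [hst, dist_self, eq_comm, abs_eq_zero] at this
  linarith

theorem IsGeodesicSegment.mono {X : Type*} [MetricSpace X] {γ : ℝ → X} {a b c d : ℝ}
    (h : IsGeodesicSegment γ a b) (hac : a ≤ c) (hdb : d ≤ b) : IsGeodesicSegment γ c d :=
  fun s hs t ht => h s (Set.Icc_subset_Icc hac hdb hs) t (Set.Icc_subset_Icc hac hdb ht)

/-- A path on `[0, 1]` with equal endpoints that is otherwise injective lies in one piece. -/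
theorem IsTreeGraded.exists_piece_of_simple_closed_path {X : Type*} [MetricSpace X]
    {PX : Set (Set X)} (hTG : IsTreeGraded X PX) {f : ℝ → X} (h01 : f 0 = f 1)
    (hf : ContinuousOn f (Set.Icc 0 1)) (hinj : Set.InjOn f (Set.Ico 0 1)) :
    ∃ Q ∈ PX, ∀ x ∈ Set.Ico (0 : ℝ) 1, f x ∈ Q := by
  obtain ⟨Q, hQ, hsub⟩ := hTG.t2 (AddCircle.liftIco 1 0 f)
    (AddCircle.liftIco_zero_continuous h01 hf) (by
      intro x y hxy
      obtain ⟨x', hx', rfl⟩ : x ∈ (fun r : ℝ => (r : AddCircle (1 : ℝ))) '' Set.Ico 0 (0 + 1) := by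
        rw [AddCircle.coe_image_Ico_eq]; trivial
      obtain ⟨y', hy', rfl⟩ : y ∈ (fun r : ℝ => (r : AddCircle (1 : ℝ))) '' Set.Ico 0 (0 + 1) := by
        rw [AddCircle.coe_image_Ico_eq]; trivial
      simp only [AddCircle.liftIco_coe_apply hx', AddCircle.liftIco_coe_apply hy'] at hxy
      rw [zero_add] at hx' hy'
      rw [hinj hx' hy' hxy])
  refine ⟨Q, hQ, fun x hx => hsub ⟨(x : AddCircle (1 : ℝ)), ?_⟩⟩
  exact AddCircle.liftIco_coe_apply (by rwa [zero_add])

/-- A geodesic with both endpoints in a piece cannot have its whole interior outside of it. -/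
theorem IsTreeGraded.exists_mem_piece_of_endpoints {X : Type*} [MetricSpace X]
    {PX : Set (Set X)} (hTG : IsTreeGraded X PX) {P : Set X} (hP : P ∈ PX)
    {γ : ℝ → X} {s u : ℝ} (hsu : s < u) (hγ : IsGeodesicSegment γ s u)
    (hs : γ s ∈ P) (hu : γ u ∈ P) : ∃ t ∈ Set.Ioo s u, γ t ∈ P := by
  by_contra! hout
  obtain ⟨η, hη, hη0, hη1, hηP⟩ := hTG.geodesicSub P hP _ hs _ hu
  have hd : dist (γ s) (γ u) = u - s := by
    rw [hγ s (Set.left_mem_Icc.2 hsu.le) u (Set.right_mem_Icc.2 hsu.le), abs_sub_comm,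
      abs_of_pos (sub_pos.2 hsu)]
  rw [hd] at hη hη1 hηP
  have hpos : 0 < u - s := sub_pos.2 hsu
  set d := u - s with hd_def
  have hmapγ : ∀ x ∈ Set.Icc (0 : ℝ) (1 / 2), s + 2 * x * d ∈ Set.Icc s u := fun x hx =>
    ⟨by nlinarith [hx.1], by nlinarith [hx.2]⟩
  have hmapη : ∀ x ∈ Set.Icc (1 / 2 : ℝ) 1, (2 - 2 * x) * d ∈ Set.Icc 0 d := fun x hx =>
    ⟨by nlinarith [hx.2], by nlinarith [hx.1]⟩
  have hmixed : ∀ x ∈ Set.Icc (0 : ℝ) (1 / 2), ∀ y ∈ Set.Ioo (1 / 2 : ℝ) 1,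
      γ (s + 2 * x * d) ≠ η ((2 - 2 * y) * d) := by
    intro x hx y hy hxy
    have hy' := hmapη y ⟨hy.1.le, hy.2.le⟩
    have hx' := hmapγ x hx
    have hxP : γ (s + 2 * x * d) ∈ P := hxy ▸ hηP _ hy'
    rcases eq_or_lt_of_le hx'.1 with h | h
    · rw [← h, ← hη0] at hxy
      have := hη.injOn (Set.left_mem_Icc.2 hpos.le) hy' hxy
      nlinarith [hy.2]
    rcases eq_or_lt_of_le hx'.2 with h' | h'
    · rw [h', ← hη1] at hxy
      have := hη.injOn (Set.right_mem_Icc.2 hpos.le) hy' hxy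
      nlinarith [hy.1]
    · exact hout _ ⟨h, h'⟩ hxP
  let f : ℝ → X := fun x => if x ≤ 1 / 2 then γ (s + 2 * x * d) else η ((2 - 2 * x) * d)
  have hf_left : ∀ x, x ≤ 1 / 2 → f x = γ (s + 2 * x * d) := fun x hx => if_pos hx
  have hf_right : ∀ x, 1 / 2 ≤ x → f x = η ((2 - 2 * x) * d) := by
    intro x hx
    rcases eq_or_lt_of_le hx with rfl | hx
    · rw [hf_left _ le_rfl, show s + 2 * (1 / 2) * d = u by rw [hd_def]; ring,
        show (2 - 2 * (1 / 2)) * d = d by ring, hη1]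
    · exact if_neg hx.not_ge
  have hcont : ContinuousOn f (Set.Icc 0 1) := by
    rw [← Set.Icc_union_Icc_eq_Icc (show (0 : ℝ) ≤ 1 / 2 by norm_num)
      (show (1 / 2 : ℝ) ≤ 1 by norm_num)]
    refine ContinuousOn.union_of_isClosed ?_ ?_ isClosed_Icc isClosed_Icc
    · exact (hγ.continuousOn.comp (by fun_prop) hmapγ).congr fun x hx => hf_left x hx.2
    · exact (hη.continuousOn.comp (by fun_prop) hmapη).congr fun x hx => hf_right x hx.1
  have hinj : Set.InjOn f (Set.Ico 0 1) := by
    intro x hx y hy hxy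
    rcases le_or_gt x (1 / 2) with hx2 | hx2 <;> rcases le_or_gt y (1 / 2) with hy2 | hy2
    · rw [hf_left x hx2, hf_left y hy2] at hxy
      have := hγ.injOn (hmapγ x ⟨hx.1, hx2⟩) (hmapγ y ⟨hy.1, hy2⟩) hxy
      have := mul_right_cancel₀ hpos.ne' (add_left_cancel this)
      linarith
    · rw [hf_left x hx2, hf_right y hy2.le] at hxy
      exact absurd hxy (hmixed x ⟨hx.1, hx2⟩ y ⟨hy2, hy.2⟩)
    · rw [hf_right x hx2.le, hf_left y hy2] at hxy
      exact absurd hxy.symm (hmixed y ⟨hy.1, hy2⟩ x ⟨hx2, hx.2⟩)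
    · rw [hf_right x hx2.le, hf_right y hy2.le] at hxy
      have := hη.injOn (hmapη x ⟨hx2.le, hx.2.le⟩) (hmapη y ⟨hy2.le, hy.2.le⟩) hxy
      have := mul_right_cancel₀ hpos.ne' this
      linarith
  have h01 : f 0 = f 1 := by
    rw [hf_left 0 (by norm_num), hf_right 1 (by norm_num)]
    simp [hη0]
  obtain ⟨Q, hQ, hfQ⟩ := hTG.exists_piece_of_simple_closed_path h01 hcont hinj
  have hsQ : γ s ∈ Q := by
    have := hfQ 0 (by norm_num)
    rw [hf_left 0 (by norm_num)] at this
    simpa using this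
  have huQ : γ u ∈ Q := by
    have := hfQ (1 / 2) (by norm_num)
    rwa [hf_right _ le_rfl, show (2 - 2 * (1 / 2)) * d = d by ring, hη1] at this
  have hPQ : P = Q := by
    by_contra hne
    have := hγ.injOn (Set.left_mem_Icc.2 hsu.le) (Set.right_mem_Icc.2 hsu.le)
      (hTG.t1 P hP Q hQ hne ⟨hs, hsQ⟩ ⟨hu, huQ⟩)
    exact hsu.ne this
  have hmid := hfQ (1 / 4) (by norm_num)
  rw [hf_left _ (by norm_num), ← hPQ] at hmid
  exact hout _ ⟨by linarith, by linarith⟩ hmid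

/-- A nonempty compact set of reals with no gaps is a closed interval. -/
theorem IsCompact.exists_eq_Icc_of_forall_exists_mem_Ioo {S : Set ℝ} (hS : IsCompact S)
    (hne : S.Nonempty)
    (hgap : ∀ s ∈ S, ∀ u ∈ S, s < u → ∃ t ∈ Set.Ioo s u, t ∈ S) :
    ∃ a b : ℝ, a ≤ b ∧ S = Set.Icc a b := by
  obtain ⟨a, haS, ha⟩ := hS.exists_isLeast hne
  obtain ⟨b, hbS, hb⟩ := hS.exists_isGreatest hne
  refine ⟨a, b, ha hbS, Set.Subset.antisymm (fun t ht => ⟨ha ht, hb ht⟩) fun t ht => ?_⟩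
  by_contra htS
  obtain ⟨s, ⟨hsS, hst⟩, hs⟩ := (hS.inter_right isClosed_Iic).exists_isGreatest
    (⟨a, haS, ht.1⟩ : (S ∩ Set.Iic t).Nonempty)
  obtain ⟨u, ⟨huS, htu⟩, hu⟩ := (hS.inter_right isClosed_Ici).exists_isLeast
    (⟨b, hbS, ht.2⟩ : (S ∩ Set.Ici t).Nonempty)
  have hst' : s < t := lt_of_le_of_ne hst fun h => htS (h ▸ hsS)
  obtain ⟨v, hv, hvS⟩ := hgap s hsS u huS (hst'.trans_le htu)
  rcases le_total v t with h | h
  · exact (hs ⟨hvS, h⟩).not_gt hv.1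
  · exact (hu ⟨hvS, h⟩).not_gt hv.2

/-- The intersection of a geodesic with a piece of a tree-graded space is either empty,
or a single point, or a closed subsegment of the geodesic. -/
theorem geodesic_inter_piece (X : Type*) [MetricSpace X] [CompleteSpace X]
    (PX : Set (Set X)) (hgeo : GeodesicSpace X) (hTG : IsTreeGraded X PX)
    (P : Set X) (hP : P ∈ PX)
    (γ : ℝ → X) (L : ℝ) (hL : 0 ≤ L) (hγ : IsGeodesicSegment γ 0 L) :
    {t ∈ Set.Icc 0 L | γ t ∈ P} = ∅ ∨
    (∃ t : ℝ, {t ∈ Set.Icc 0 L | γ t ∈ P} = {t}) ∨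
    (∃ a b : ℝ, a < b ∧ {t ∈ Set.Icc 0 L | γ t ∈ P} = Set.Icc a b) := by
  rcases Set.eq_empty_or_nonempty {t ∈ Set.Icc 0 L | γ t ∈ P} with h | hne
  · exact Or.inl h
  have hcompact : IsCompact {t ∈ Set.Icc 0 L | γ t ∈ P} :=
    isCompact_Icc.of_isClosed_subset
      (hγ.continuousOn.preimage_isClosed_of_isClosed isClosed_Icc (hTG.closed P hP))
      (Set.sep_subset _ _)
  obtain ⟨a, b, hab, h⟩ := hcompact.exists_eq_Icc_of_forall_exists_mem_Ioo hne (by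
    rintro s ⟨hs, hsP⟩ u ⟨hu, huP⟩ hsu
    obtain ⟨t, ht, htP⟩ :=
      hTG.exists_mem_piece_of_endpoints hP hsu (hγ.mono hs.1 hu.2) hsP huP
    exact ⟨t, ht, ⟨hs.1.trans ht.1.le, ht.2.le.trans hu.2⟩, htP⟩)
  rcases hab.eq_or_lt with rfl | hab
  · exact Or.inr (Or.inl ⟨a, by rw [h, Set.Icc_self]⟩)
  · exact Or.inr (Or.inr ⟨a, b, hab, h⟩)
end
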